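/- arXiv:0908.2350 — 3 statements merged into one kernel-verified Lean document; each statement's English description precedes it below -/
import Mathlib

section
/- For every irrational x ∈ [0,1], sup over positive integers n of c({n²·x}) = ∞, where {y} denotes the fractional part of y and c(s) = limsup_k a_k(s) is the limsup of the continued fraction coefficients of an irrational s ∈ (0,1). Equivalently: for every M > 0 there exists a positive integer n such that the continued fraction coefficients of {n²·x} satisfy a_k({n²·x}) > M for infinitely many k. -/
open Filter

/-- The Gauss map `G(x) = 1/x − ⌊1/x⌋`. -/
noncomputable def gaussMap (x : ℝ) : ℝ := Int.fract x⁻¹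

/-- The `k`-th continued fraction coefficient `a_k(x) = ⌊1/G^(k−1)(x)⌋` (for `k ≥ 1`). -/
noncomputable def cfCoeff (x : ℝ) (k : ℕ) : ℤ := ⌊(gaussMap^[k - 1] x)⁻¹⌋

/-- `c(s) = limsup_k a_k(s)`, computed in the extended reals. -/
noncomputable def cfLimsup (s : ℝ) : EReal :=
  Filter.limsup (fun k : ℕ => ((cfCoeff s (k + 1) : ℝ) : EReal)) Filter.atTop

lemma log_factorial_eq_sum_primesLE (n : ℕ) :
    Real.log (n.factorial : ℝ) =
      ∑ p ∈ n.primesLE, (n.factorial.factorization p : ℝ) * Real.log p := by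
  rw [Real.log_nat_eq_sum_factorization, Finsupp.sum]
  apply Finset.sum_subset
  · intro p hp
    rw [Nat.support_factorization, Nat.mem_primeFactors] at hp
    rw [Nat.mem_primesLE]
    exact ⟨(hp.1.dvd_factorial).1 hp.2.1, hp.1⟩
  · intro p _ hp
    rw [Finsupp.notMem_support_iff] at hp
    simp [hp]

lemma mertens_lower (n : ℕ) (hn : 1 ≤ n) :
    2 / 3 * Real.log n - 2 ≤ ∑ p ∈ n.primesLE, Real.log p / p := by
  have hn0 : (0 : ℝ) < n := by exact_mod_cast hn
  have h1 : n * Real.log n - n ≤ Real.log (n.factorial : ℝ) := by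
    have h := Real.pow_div_factorial_le_exp (n : ℝ) hn0.le n
    have hf : (0 : ℝ) < n.factorial := by exact_mod_cast n.factorial_pos
    have h2 := Real.log_le_log (by positivity) h
    rw [Real.log_exp, Real.log_div (by positivity) hf.ne', Real.log_pow] at h2
    linarith
  have h2 : Real.log (n.factorial : ℝ) ≤
      ∑ p ∈ n.primesLE, n * (3 / 2 * (Real.log p / p) + if p = 2 then Real.log 2 else 0) := by
    rw [log_factorial_eq_sum_primesLE]
    apply Finset.sum_le_sum
    intro p hp
    rw [Nat.mem_primesLE] at hp
    have h3 : ((n.factorial.factorization p : ℕ) : ℝ) ≤ n / ((p : ℝ) - 1) := by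
      have := Nat.factorization_factorial_le_div_pred hp.2 n
      have h4 : ((n / (p - 1) : ℕ) : ℝ) ≤ (n : ℝ) / ((p - 1 : ℕ) : ℝ) := Nat.cast_div_le
      rw [Nat.cast_sub hp.2.one_le, Nat.cast_one] at h4
      exact le_trans (by exact_mod_cast this) h4
    have hlog : 0 ≤ Real.log p := Real.log_natCast_nonneg p
    refine (mul_le_mul_of_nonneg_right h3 hlog).trans ?_
    rw [div_mul_eq_mul_div, mul_div_assoc]
    refine mul_le_mul_of_nonneg_left ?_ hn0.le
    by_cases h : p = 2
    · subst h
      norm_num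
      linarith [Real.log_pos one_lt_two]
    · rw [if_neg h, add_zero]
      have hp3 : (3 : ℝ) ≤ p := by
        have := hp.2.two_le
        exact_mod_cast (by omega : 3 ≤ p)
      rw [← mul_div_assoc, div_le_div_iff₀ (by linarith) (by linarith)]
      nlinarith
  rw [← Finset.mul_sum, Finset.sum_add_distrib, ← Finset.mul_sum] at h2
  have h5 : ∑ p ∈ n.primesLE, (if p = 2 then Real.log 2 else 0) ≤ Real.log 2 := by
    rw [Finset.sum_ite_eq']
    split_ifs
    · exact le_rfl
    · exact (Real.log_pos one_lt_two).le
  have h6 : n * (Real.log n - 1) ≤ n * (3 / 2 * ∑ p ∈ n.primesLE, Real.log p / p + Real.log 2) := by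
    refine le_trans ?_ (h2.trans (mul_le_mul_of_nonneg_left (by linarith) hn0.le))
    linarith
  have h7 := le_of_mul_le_mul_left h6 hn0
  linarith [Real.log_two_lt_d9]

lemma sum_primesLE_log_le (n : ℕ) : ∑ p ∈ n.primesLE, Real.log p ≤ Real.log 4 * n := by
  rw [← Chebyshev.theta_eq_sum_primesLE_log]
  exact Chebyshev.theta_le_log4_mul_x (by positivity)

lemma log_four_le : Real.log 4 ≤ 2 := by
  rw [show (4 : ℝ) = 2 ^ 2 by norm_num, Real.log_pow]
  push_cast
  linarith [Real.log_two_lt_d9]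

lemma mertens_upper (n : ℕ) (hn : 1 ≤ n) :
    ∑ p ∈ n.primesLE, Real.log p / p ≤ Real.log n + 2 := by
  have hn0 : (0 : ℝ) < n := by exact_mod_cast hn
  have h1 : Real.log (n.factorial : ℝ) ≤ n * Real.log n := by
    rw [← Real.log_pow]
    apply Real.log_le_log (by exact_mod_cast n.factorial_pos)
    exact_mod_cast Nat.factorial_le_pow n
  have h2 : ∑ p ∈ n.primesLE, (n * (Real.log p / p) - Real.log p) ≤
      Real.log (n.factorial : ℝ) := by
    rw [log_factorial_eq_sum_primesLE]
    apply Finset.sum_le_sum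
    intro p hp
    rw [Nat.mem_primesLE] at hp
    have hp0 : (0 : ℝ) < p := by exact_mod_cast hp.2.pos
    have h3 : (n : ℝ) / p - 1 ≤ (n.factorial.factorization p : ℝ) := by
      have h4 : n / p ≤ n.factorial.factorization p := by
        rw [Nat.factorization_factorial hp.2 (Nat.lt_succ_self _)]
        have : n / p = ∑ i ∈ Finset.Ico 1 2, n / p ^ i := by simp
        rw [this]
        apply Finset.sum_le_sum_of_subset
        apply Finset.Ico_subset_Ico_right
        have := Nat.log_pos hp.2.one_lt hp.1
        omega
      have h5 : (n : ℝ) / p < ((n / p : ℕ) : ℝ) + 1 := by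
        rw [← Nat.floor_div_eq_div (K := ℝ)]
        exact Nat.lt_floor_add_one _
      have h6 : ((n / p : ℕ) : ℝ) ≤ (n.factorial.factorization p : ℝ) := by exact_mod_cast h4
      linarith
    have := mul_le_mul_of_nonneg_right h3 (Real.log_natCast_nonneg p)
    calc _ = ((n : ℝ) / p - 1) * Real.log p := by ring
      _ ≤ _ := this
  rw [Finset.sum_sub_distrib, ← Finset.mul_sum] at h2
  have h3 := sum_primesLE_log_le n
  have h4 : n * ∑ p ∈ n.primesLE, Real.log p / p ≤ n * (Real.log n + 2) := by
    nlinarith [log_four_le]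
  exact le_of_mul_le_mul_left h4 hn0

lemma card_sq_le_card_mul_sum_ite {α β : Type*} [Fintype β] [DecidableEq β]
    (s : Finset α) (f : α → β) :
    (s.card : ℝ) ^ 2 ≤ Fintype.card β * ∑ x ∈ s, ∑ y ∈ s, if f x = f y then (1 : ℝ) else 0 := by
  have h1 : (s.card : ℝ) = ∑ b : β, ∑ x ∈ s, if f x = b then (1 : ℝ) else 0 := by
    rw [Finset.sum_comm]
    simp
  have h2 : ∑ x ∈ s, ∑ y ∈ s, (if f x = f y then (1 : ℝ) else 0) =
      ∑ b : β, (∑ x ∈ s, if f x = b then (1 : ℝ) else 0) ^ 2 := by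
    have h3 : ∀ b : β, (∑ x ∈ s, if f x = b then (1 : ℝ) else 0) ^ 2 =
        ∑ x ∈ s, ∑ y ∈ s, (if f x = b then (1 : ℝ) else 0) * (if f y = b then (1 : ℝ) else 0) := by
      intro b
      rw [sq, Finset.sum_mul_sum]
    simp_rw [h3]
    rw [Finset.sum_comm (s := Finset.univ)]
    apply Finset.sum_congr rfl
    intro x _
    rw [Finset.sum_comm (s := Finset.univ)]
    apply Finset.sum_congr rfl
    intro y _
    simp [eq_comm]
  rw [h1, h2]
  exact sq_sum_le_card_mul_sum_sq

lemma sq_sub_mul_sq_ne_zero {D : ℤ} (hD : ¬ IsSquare D) {a b : ℤ} (h : a ≠ 0 ∨ b ≠ 0) :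
    a ^ 2 - D * b ^ 2 ≠ 0 := by
  intro h0
  by_cases hb : b = 0
  · subst hb
    simp at h0 h
    exact h h0
  · apply hD
    have h1 : b ^ 2 ∣ a ^ 2 := ⟨D, by linarith⟩
    obtain ⟨c, rfl⟩ := (Int.pow_dvd_pow_iff two_ne_zero).1 h1
    refine ⟨c, ?_⟩
    have : b ^ 2 * (c * c - D) = 0 := by linarith
    rcases mul_eq_zero.1 this with h2 | h2
    · exact absurd (pow_eq_zero_iff two_ne_zero |>.1 h2) hb
    · linarith

lemma split_sum_le {D : ℤ} (hD : ¬ IsSquare D) {L : ℕ} (hL : 1 ≤ L) (P : Finset ℕ)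
    (hP : ∀ p ∈ P, p.Prime ∧ p ≠ 2 ∧ ¬ (p : ℤ) ∣ D ∧ p ≤ L ^ 2 ∧ IsSquare (D : ZMod p)) :
    2 * ∑ p ∈ P, Real.log p / p ≤ 2 * Real.log L + Real.log (1 + |(D : ℝ)|) + 4 := by
  have hρ : ∀ p : ℕ, ∃ r : ZMod p, p ∈ P → r ^ 2 = (D : ZMod p) := by
    intro p
    by_cases h : p ∈ P
    · obtain ⟨r, hr⟩ := (hP p h).2.2.2.2
      exact ⟨r, fun _ => by rw [hr, sq]⟩
    · exact ⟨0, fun h' => absurd h' h⟩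
  choose ρ hρ using hρ
  set box : Finset (ℕ × ℕ) := Finset.range L ×ˢ Finset.range L with hbox
  have hcard : (box.card : ℝ) = (L : ℝ) ^ 2 := by
    rw [hbox, Finset.card_product, Finset.card_range]
    push_cast
    ring
  set f : ∀ p : ℕ, ℕ × ℕ → ZMod p := fun p x => (x.1 : ZMod p) - ρ p * x.2 with hf
  set g : ∀ p : ℕ, ℕ × ℕ → ZMod p := fun p x => (x.1 : ZMod p) + ρ p * x.2 with hg
  set e : ℕ → ℕ × ℕ → ℕ × ℕ → ℕ := fun p x y =>
    (if f p x = f p y then 1 else 0) + (if g p x = g p y then 1 else 0) with he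
  have hL0 : (0 : ℝ) < L := by exact_mod_cast hL
  have hlogD : 0 ≤ Real.log (1 + |(D : ℝ)|) := Real.log_nonneg (by linarith [abs_nonneg (D : ℝ)])
  have hlogL : 0 ≤ Real.log L := Real.log_natCast_nonneg L
  have hoff : ∀ x ∈ box, ∀ y ∈ box, x ≠ y →
      ∑ p ∈ P, (e p x y : ℝ) * Real.log p ≤ 2 * Real.log L + Real.log (1 + |(D : ℝ)|) := by
    intro x hx y hy hxy
    set a : ℤ := (x.1 : ℤ) - y.1 with ha
    set b : ℤ := (x.2 : ℤ) - y.2 with hb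
    simp only [hbox, Finset.mem_product, Finset.mem_range] at hx hy
    have hab : a ≠ 0 ∨ b ≠ 0 := by
      by_contra! hc
      apply hxy
      ext <;> omega
    have hN := sq_sub_mul_sq_ne_zero hD hab
    set N := a ^ 2 - D * b ^ 2 with hNdef
    have hdvd : ∏ p ∈ P, ((p : ℤ) ^ e p x y) ∣ N := by
      apply Finset.prod_dvd_of_coprime
      · intro p hp q hq hpq
        exact (Nat.isCoprime_iff_coprime.2
          ((Nat.coprime_primes (hP p hp).1 (hP q hq).1).2 hpq)).pow
      · intro p hp
        obtain ⟨hp1, hp2, hp3, -, -⟩ := hP p hp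
        have := Fact.mk hp1
        have hr := hρ p hp
        have hfac : (N : ZMod p) = ((a : ZMod p) - ρ p * b) * (a + ρ p * b) := by
          rw [hNdef]
          push_cast
          rw [← hr]
          ring
        have hf' : f p x = f p y ↔ (a : ZMod p) - ρ p * b = 0 := by
          simp only [hf, ha, hb]
          push_cast
          rw [← sub_eq_zero]
          ring_nf
        have hg' : g p x = g p y ↔ (a : ZMod p) + ρ p * b = 0 := by
          simp only [hg, ha, hb]
          push_cast
          rw [← sub_eq_zero]
          ring_nf
        simp only [he]
        by_cases h1 : f p x = f p y <;> by_cases h2 : g p x = g p y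
        · rw [if_pos h1, if_pos h2]
          rw [hf'] at h1
          rw [hg'] at h2
          have h2ne : (2 : ZMod p) ≠ 0 := by
            intro h
            have : ((2 : ℕ) : ZMod p) = 0 := by exact_mod_cast h
            rw [ZMod.natCast_eq_zero_iff] at this
            exact hp2 ((Nat.prime_dvd_prime_iff_eq hp1 Nat.prime_two).1 this)
          have hρne : ρ p ≠ 0 := by
            intro h
            rw [h] at hr
            apply hp3
            rw [← ZMod.intCast_zmod_eq_zero_iff_dvd, ← hr]
            simp
          have ha0 : (a : ZMod p) = 0 := by
            have : (2 : ZMod p) * a = 0 := by linear_combination h1 + h2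
            exact (mul_eq_zero.1 this).resolve_left h2ne
          have hb0 : (b : ZMod p) = 0 := by
            rw [ha0] at h1
            have : ρ p * (b : ZMod p) = 0 := by linear_combination -h1
            exact (mul_eq_zero.1 this).resolve_left hρne
          rw [ZMod.intCast_zmod_eq_zero_iff_dvd] at ha0 hb0
          exact dvd_sub (pow_dvd_pow_of_dvd ha0 2) ((pow_dvd_pow_of_dvd hb0 2).mul_left _)
        · rw [if_pos h1, if_neg h2]
          rw [hf'] at h1
          rw [add_zero, pow_one, ← ZMod.intCast_zmod_eq_zero_iff_dvd, hfac, h1, zero_mul]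
        · rw [if_neg h1, if_pos h2]
          rw [hg'] at h2
          rw [zero_add, pow_one, ← ZMod.intCast_zmod_eq_zero_iff_dvd, hfac, h2, mul_zero]
        · rw [if_neg h1, if_neg h2]
          simp
    have hle : ((∏ p ∈ P, (p ^ e p x y) : ℕ) : ℝ) ≤ (L : ℝ) ^ 2 * (1 + |(D : ℝ)|) := by
      have h1 : ((∏ p ∈ P, (p ^ e p x y) : ℕ) : ℝ) ≤ |(N : ℝ)| := by
        have := Int.le_of_dvd (abs_pos.2 hN) ((dvd_abs _ _).2 hdvd)
        rw [← Int.cast_abs]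
        exact_mod_cast this
      refine h1.trans ?_
      have ha2 : (a : ℝ) ^ 2 ≤ (L : ℝ) ^ 2 := by
        apply sq_le_sq'
        · exact_mod_cast (by omega : -(L : ℤ) ≤ a)
        · exact_mod_cast (by omega : a ≤ (L : ℤ))
      have hb2 : (b : ℝ) ^ 2 ≤ (L : ℝ) ^ 2 := by
        apply sq_le_sq'
        · exact_mod_cast (by omega : -(L : ℤ) ≤ b)
        · exact_mod_cast (by omega : b ≤ (L : ℤ))
      rw [hNdef]
      push_cast
      calc |(a : ℝ) ^ 2 - D * (b : ℝ) ^ 2| ≤ |(a : ℝ) ^ 2| + |D * (b : ℝ) ^ 2| := abs_sub _ _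
        _ = (a : ℝ) ^ 2 + |(D : ℝ)| * (b : ℝ) ^ 2 := by
          rw [abs_mul, abs_of_nonneg (sq_nonneg (a : ℝ)), abs_of_nonneg (sq_nonneg (b : ℝ))]
        _ ≤ (L : ℝ) ^ 2 + |(D : ℝ)| * (L : ℝ) ^ 2 := by gcongr
        _ = _ := by ring
    have hpos : ∀ p ∈ P, ((p : ℝ) ^ e p x y) ≠ 0 := by
      intro p hp
      have : (p : ℝ) ≠ 0 := by exact_mod_cast (hP p hp).1.ne_zero
      positivity
    have h3 := Real.log_le_log (by
      have : 0 < ∏ p ∈ P, (p ^ e p x y) := Finset.prod_pos fun p hp => pow_pos (hP p hp).1.pos _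
      exact_mod_cast this) hle
    rw [Real.log_mul (by positivity) (by positivity), Real.log_pow] at h3
    push_cast at h3
    rw [Real.log_prod hpos] at h3
    simpa [Real.log_pow] using h3
  have hsum_le : ∑ x ∈ box, ∑ y ∈ box, ∑ p ∈ P, (e p x y : ℝ) * Real.log p ≤
      (L : ℝ) ^ 4 * (2 * Real.log L + Real.log (1 + |(D : ℝ)|)) +
        (L : ℝ) ^ 2 * (2 * ∑ p ∈ P, Real.log p) := by
    have hpt : ∀ x ∈ box, ∀ y ∈ box, ∑ p ∈ P, (e p x y : ℝ) * Real.log p ≤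
        (2 * Real.log L + Real.log (1 + |(D : ℝ)|)) +
          if x = y then 2 * ∑ p ∈ P, Real.log p else 0 := by
      intro x hx y hy
      by_cases hxy : x = y
      · subst hxy
        rw [if_pos rfl]
        have : ∑ p ∈ P, (e p x x : ℝ) * Real.log p = 2 * ∑ p ∈ P, Real.log p := by
          rw [Finset.mul_sum]
          apply Finset.sum_congr rfl
          intro p _
          norm_num [he]
        linarith
      · rw [if_neg hxy, add_zero]
        exact hoff x hx y hy hxy
    refine (Finset.sum_le_sum fun x hx => Finset.sum_le_sum fun y hy => hpt x hx y hy).trans ?_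
    have : ∀ x ∈ box, ∑ y ∈ box, ((2 * Real.log L + Real.log (1 + |(D : ℝ)|)) +
          if x = y then 2 * ∑ p ∈ P, Real.log p else 0) =
          (L : ℝ) ^ 2 * (2 * Real.log L + Real.log (1 + |(D : ℝ)|)) +
            2 * ∑ p ∈ P, Real.log p := by
      intro x hx
      rw [Finset.sum_add_distrib, Finset.sum_const, nsmul_eq_mul, hcard, Finset.sum_ite_eq,
        if_pos hx]
    rw [Finset.sum_congr rfl this, Finset.sum_const, nsmul_eq_mul, hcard]
    apply le_of_eq
    ring
  have hsum_ge : (L : ℝ) ^ 4 * (2 * ∑ p ∈ P, Real.log p / p) ≤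
      ∑ x ∈ box, ∑ y ∈ box, ∑ p ∈ P, (e p x y : ℝ) * Real.log p := by
    have hsw : ∑ x ∈ box, ∑ y ∈ box, ∑ p ∈ P, (e p x y : ℝ) * Real.log p =
        ∑ p ∈ P, (∑ x ∈ box, ∑ y ∈ box, (e p x y : ℝ)) * Real.log p := by
      simp_rw [Finset.sum_mul]
      rw [Finset.sum_comm (s := P)]
      refine Finset.sum_congr rfl fun x _ => ?_
      rw [Finset.sum_comm (s := P)]
    rw [hsw, Finset.mul_sum, Finset.mul_sum]
    apply Finset.sum_le_sum
    intro p hp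
    have := Fact.mk (hP p hp).1
    have hp0 : (0 : ℝ) < p := by exact_mod_cast (hP p hp).1.pos
    have h1 := card_sq_le_card_mul_sum_ite box (f p)
    have h2 := card_sq_le_card_mul_sum_ite box (g p)
    rw [ZMod.card, hcard] at h1 h2
    have h3 : ∑ x ∈ box, ∑ y ∈ box, (e p x y : ℝ) =
        (∑ x ∈ box, ∑ y ∈ box, if f p x = f p y then (1 : ℝ) else 0) +
        (∑ x ∈ box, ∑ y ∈ box, if g p x = g p y then (1 : ℝ) else 0) := by
      simp_rw [← Finset.sum_add_distrib]
      simp [he]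
    rw [h3]
    have h4 : (L : ℝ) ^ 4 * (2 * (1 / p)) ≤ 
        (∑ x ∈ box, ∑ y ∈ box, if f p x = f p y then (1 : ℝ) else 0) +
        (∑ x ∈ box, ∑ y ∈ box, if g p x = g p y then (1 : ℝ) else 0) := by
      rw [← mul_assoc, mul_one_div, div_le_iff₀ hp0]
      nlinarith
    calc _ = (L : ℝ) ^ 4 * (2 * (1 / p)) * Real.log p := by ring
      _ ≤ _ := mul_le_mul_of_nonneg_right h4 (Real.log_natCast_nonneg p)
  have hth : ∑ p ∈ P, Real.log p ≤ 2 * (L : ℝ) ^ 2 := by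
    have h1 : ∑ p ∈ P, Real.log p ≤ ∑ p ∈ (L ^ 2).primesLE, Real.log p := by
      apply Finset.sum_le_sum_of_subset_of_nonneg
      · intro p hp
        exact Nat.mem_primesLE.2 ⟨(hP p hp).2.2.2.1, (hP p hp).1⟩
      · intro p _ _
        exact Real.log_natCast_nonneg p
    refine h1.trans ((sum_primesLE_log_le _).trans ?_)
    push_cast
    exact mul_le_mul_of_nonneg_right log_four_le (by positivity)
  have h4 : (0 : ℝ) < (L : ℝ) ^ 4 := by positivity
  refine le_of_mul_le_mul_left (hsum_ge.trans (hsum_le.trans ?_)) h4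
  nlinarith [mul_le_mul_of_nonneg_left hth (by positivity : (0 : ℝ) ≤ 2 * (L : ℝ) ^ 2)]

lemma sum_log_primeFactors_le {N : ℕ} (hN : N ≠ 0) :
    ∑ p ∈ N.primeFactors, Real.log p ≤ Real.log N := by
  rw [← Real.log_prod (fun p hp => by
    have := (Nat.prime_of_mem_primeFactors hp).ne_zero
    exact_mod_cast this)]
  apply Real.log_le_log
  · exact Finset.prod_pos fun p hp => by
      have := (Nat.prime_of_mem_primeFactors hp).pos
      exact_mod_cast this
  · rw [← Nat.cast_prod]
    exact_mod_cast Nat.le_of_dvd (Nat.pos_of_ne_zero hN) (Nat.prod_primeFactors_dvd N)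

lemma sum_log_div_le_of_card_lt {n : ℕ} (hn : 3 ≤ n) (I : Finset ℕ) (hI : ∀ p ∈ I, p.Prime)
    (hcard : I.card < n) : ∑ p ∈ I, Real.log p / p ≤ 2 * Real.log n + 2 := by
  have hn0 : (0 : ℝ) < n := by exact_mod_cast (by omega : 0 < n)
  have h1 : ∑ p ∈ I, Real.log p / p ≤ ∑ p ∈ I, ((if p ≤ n then Real.log p / p else 0) +
      Real.log n / n) := by
    apply Finset.sum_le_sum
    intro p hp
    split_ifs with h
    · have : 0 ≤ Real.log n / n := div_nonneg (Real.log_natCast_nonneg n) hn0.le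
      linarith
    · rw [zero_add]
      have hexp : Real.exp 1 ≤ n := by
        have : (3 : ℝ) ≤ n := by exact_mod_cast hn
        linarith [Real.exp_one_lt_d9]
      push Not at h
      have h' : (n : ℝ) ≤ p := by exact_mod_cast h.le
      exact Real.log_div_self_antitoneOn hexp (hexp.trans h') h'
  rw [Finset.sum_add_distrib, Finset.sum_const, nsmul_eq_mul, ← Finset.sum_filter] at h1
  have h2 : ∑ p ∈ I with p ≤ n, Real.log p / p ≤ ∑ p ∈ n.primesLE, Real.log p / p := by
    apply Finset.sum_le_sum_of_subset_of_nonneg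
    · intro p hp
      rw [Finset.mem_filter] at hp
      exact Nat.mem_primesLE.2 ⟨hp.2, hI p hp.1⟩
    · intro p _ _
      exact div_nonneg (Real.log_natCast_nonneg p) (Nat.cast_nonneg p)
  have h3 : (I.card : ℝ) * (Real.log n / n) ≤ Real.log n := by
    have h4 : (I.card : ℝ) ≤ n := by exact_mod_cast hcard.le
    calc (I.card : ℝ) * (Real.log n / n) ≤ n * (Real.log n / n) :=
          mul_le_mul_of_nonneg_right h4 (div_nonneg (Real.log_natCast_nonneg n) hn0.le)
      _ = Real.log n := by field_simp
  linarith [mertens_upper n (by omega)]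

open Classical in
lemma exists_many_inert_primes : ∃ K n₀ : ℕ, ∀ n ≥ n₀, ∀ D : ℤ, ¬ IsSquare D → |D| ≤ n →
    n ≤ ((n ^ K).primesLE.filter fun p : ℕ => p ≠ 2 ∧ ¬ IsSquare (D : ZMod p)).card := by
  refine ⟨36, ⌈Real.exp 7⌉₊ + 3, fun n hn D hD hDn => ?_⟩
  by_contra! hlt
  have hn3 : 3 ≤ n := by omega
  have hn0 : (0 : ℝ) < n := by exact_mod_cast (by omega : 0 < n)
  have hlogn : 7 ≤ Real.log n := by
    rw [Real.le_log_iff_exp_le hn0]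
    refine (Nat.le_ceil _).trans ?_
    exact_mod_cast (by omega : ⌈Real.exp 7⌉₊ ≤ n)
  have hD0 : D ≠ 0 := by
    rintro rfl
    exact hD ⟨0, by simp⟩
  set I := (n ^ 36).primesLE.filter fun p : ℕ => p ≠ 2 ∧ ¬ IsSquare (D : ZMod p) with hI
  set P := (n ^ 36).primesLE.filter fun p : ℕ => p ≠ 2 ∧ ¬ (p : ℤ) ∣ D ∧ IsSquare (D : ZMod p) with hP
  set R := (2 * D.natAbs).primeFactors with hR
  have hpow : n ^ 36 = (n ^ 18) ^ 2 := by ring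
  have hcover : (n ^ 36).primesLE ⊆ (I ∪ P) ∪ R := by
    intro p hp
    have hp' := (Nat.mem_primesLE.1 hp).2
    by_cases h2 : p = 2 ∨ (p : ℤ) ∣ D
    · apply Finset.mem_union_right
      rw [hR, Nat.mem_primeFactors]
      refine ⟨hp', ?_, by simpa using hD0⟩
      rcases h2 with rfl | h2
      · exact dvd_mul_right _ _
      · exact (Int.natCast_dvd.1 h2).mul_left _
    · push Not at h2
      apply Finset.mem_union_left
      by_cases h3 : IsSquare (D : ZMod p)
      · exact Finset.mem_union_right _ (Finset.mem_filter.2 ⟨hp, h2.1, h2.2, h3⟩)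
      · exact Finset.mem_union_left _ (Finset.mem_filter.2 ⟨hp, h2.1, h3⟩)
  have hnn : ∀ p : ℕ, 0 ≤ Real.log p / p := fun p =>
    div_nonneg (Real.log_natCast_nonneg p) (Nat.cast_nonneg p)
  have hun : ∀ A B : Finset ℕ, ∑ p ∈ A ∪ B, Real.log p / p ≤
      ∑ p ∈ A, Real.log p / p + ∑ p ∈ B, Real.log p / p := by
    intro A B
    rw [← Finset.sum_union_inter]
    linarith [Finset.sum_nonneg (s := A ∩ B) fun p _ => hnn p]
  have hS : ∑ p ∈ (n ^ 36).primesLE, Real.log p / p ≤ (∑ p ∈ I, Real.log p / p +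
      ∑ p ∈ P, Real.log p / p) + ∑ p ∈ R, Real.log p / p :=
    (Finset.sum_le_sum_of_subset_of_nonneg hcover fun p _ _ => hnn p).trans
      ((hun _ _).trans (add_le_add (hun _ _) le_rfl))
  have hlow := mertens_lower (n ^ 36) (Nat.one_le_pow _ _ (by omega))
  have hIb := sum_log_div_le_of_card_lt hn3 I
    (fun p hp => (Nat.mem_primesLE.1 (Finset.mem_filter.1 hp).1).2) hlt
  have hPb := split_sum_le hD (L := n ^ 18) (Nat.one_le_pow _ _ (by omega)) P (by
    intro p hp
    have h1 := Finset.mem_filter.1 hp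
    have h2 := Nat.mem_primesLE.1 h1.1
    exact ⟨h2.2, h1.2.1, h1.2.2.1, hpow ▸ h2.1, h1.2.2.2⟩)
  have hDr : |(D : ℝ)| ≤ n := by exact_mod_cast hDn
  have hn3' : (3 : ℝ) ≤ n := by exact_mod_cast hn3
  have hlogD : Real.log (1 + |(D : ℝ)|) ≤ 2 * Real.log n := by
    have h1 : 1 + |(D : ℝ)| ≤ (n : ℝ) ^ 2 := by nlinarith
    have h2 := Real.log_le_log (by positivity) h1
    rw [Real.log_pow] at h2
    exact_mod_cast h2
  have hRb : ∑ p ∈ R, Real.log p / p ≤ 2 * Real.log n := by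
    have h1 : ∑ p ∈ R, Real.log p / p ≤ ∑ p ∈ R, Real.log p := by
      apply Finset.sum_le_sum
      intro p hp
      have : (1 : ℝ) ≤ p := by exact_mod_cast (Nat.prime_of_mem_primeFactors hp).one_le
      exact div_le_self (Real.log_natCast_nonneg p) this
    refine h1.trans ((sum_log_primeFactors_le (by simpa using hD0)).trans ?_)
    have h2 : ((2 * D.natAbs : ℕ) : ℝ) ≤ (n : ℝ) ^ 2 := by
      have h3 : ((D.natAbs : ℕ) : ℝ) ≤ n := by
        rw [Nat.cast_natAbs, Int.cast_abs]
        exact hDr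
      push_cast
      nlinarith
    have h4 := Real.log_le_log (by
      have : 0 < 2 * D.natAbs := by omega
      exact_mod_cast this) h2
    rw [Real.log_pow] at h4
    exact_mod_cast h4
  push_cast at hlow hPb
  rw [Real.log_pow] at hlow hPb
  push_cast at hlow hPb
  linarith

/-- The binary quadratic form `a x² + 2 b x y + c y²`. -/
structure BinForm where
  a : ℝ
  b : ℝ
  c : ℝ

namespace BinForm

/-- The value of a form at a vector. -/
def ev (Q : BinForm) (x y : ℝ) : ℝ := Q.a * x ^ 2 + 2 * Q.b * x * y + Q.c * y ^ 2

/-- Precomposition with `diag(n⁻¹, n)`. -/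
noncomputable def dil (Q : BinForm) (n : ℝ) : BinForm := ⟨Q.a / n ^ 2, Q.b, Q.c * n ^ 2⟩

/-- Precomposition with an integral matrix. -/
def act (Q : BinForm) (W : Matrix (Fin 2) (Fin 2) ℤ) : BinForm :=
  ⟨Q.ev (W 0 0) (W 1 0),
    Q.a * W 0 0 * W 0 1 + Q.b * (W 0 0 * W 1 1 + W 0 1 * W 1 0) + Q.c * W 1 0 * W 1 1,
    Q.ev (W 0 1) (W 1 1)⟩

/-- Positive definite forms of determinant one. -/
def IsUnimodular (Q : BinForm) : Prop := 0 < Q.a ∧ Q.a * Q.c - Q.b ^ 2 = 1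

/-- All dilations by `m ≤ B` take values at least `δ` at nonzero integral vectors. -/
def Good (δ : ℝ) (B : ℕ) (Q : BinForm) : Prop :=
  ∀ m : ℕ, 1 ≤ m → m ≤ B → ∀ x y : ℤ, (x ≠ 0 ∨ y ≠ 0) → δ ≤ (Q.dil m).ev x y

lemma ev_dil (Q : BinForm) {n : ℝ} (hn : n ≠ 0) (x y : ℝ) :
    (Q.dil n).ev x y = Q.ev (x / n) (n * y) := by
  simp only [ev, dil]
  field_simp

lemma ev_act (Q : BinForm) (W : Matrix (Fin 2) (Fin 2) ℤ) (x y : ℝ) :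
    (Q.act W).ev x y = Q.ev (W 0 0 * x + W 0 1 * y) (W 1 0 * x + W 1 1 * y) := by
  simp only [ev, act]
  ring

lemma ev_mul (Q : BinForm) (t x y : ℝ) : Q.ev (t * x) (t * y) = t ^ 2 * Q.ev x y := by
  simp only [ev]
  ring

lemma dil_one (Q : BinForm) : Q.dil 1 = Q := by
  simp [dil]

lemma dil_dil (Q : BinForm) (m n : ℝ) : (Q.dil m).dil n = Q.dil (m * n) := by
  simp only [dil, mul_pow, mk.injEq, true_and]
  exact ⟨div_div _ _ _, mul_assoc _ _ _⟩

namespace IsUnimodular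

variable {Q : BinForm}

lemma c_pos (h : Q.IsUnimodular) : 0 < Q.c := by
  obtain ⟨h1, h2⟩ := h
  by_contra! hc
  nlinarith [sq_nonneg Q.b]

lemma sq_add_sq_le (h : Q.IsUnimodular) (x y : ℝ) :
    x ^ 2 + y ^ 2 ≤ (Q.a + Q.c) * Q.ev x y := by
  obtain ⟨h1, h2⟩ := h
  have : (Q.a + Q.c) * Q.ev x y - (x ^ 2 + y ^ 2) =
      (Q.a * x + Q.b * y) ^ 2 + (Q.b * x + Q.c * y) ^ 2 +
        (Q.a * Q.c - Q.b ^ 2 - 1) * (x ^ 2 + y ^ 2) := by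
    simp only [ev]
    ring
  rw [h2] at this
  nlinarith [sq_nonneg (Q.a * x + Q.b * y), sq_nonneg (Q.b * x + Q.c * y)]

lemma ev_nonneg (h : Q.IsUnimodular) (x y : ℝ) : 0 ≤ Q.ev x y := by
  have h1 := h.sq_add_sq_le x y
  have h2 := h.c_pos
  have h3 := h.1
  by_contra! hc
  nlinarith [sq_nonneg x, sq_nonneg y]

lemma ev_add_le (h : Q.IsUnimodular) (x y x' y' : ℝ) :
    Q.ev (x + x') (y + y') ≤ 2 * Q.ev x y + 2 * Q.ev x' y' := by
  have h1 := h.ev_nonneg (x - x') (y - y')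
  have h2 : Q.ev (x + x') (y + y') + Q.ev (x - x') (y - y') =
      2 * Q.ev x y + 2 * Q.ev x' y' := by
    simp only [ev]
    ring
  linarith

lemma dil (h : Q.IsUnimodular) {n : ℝ} (hn : n ≠ 0) : (Q.dil n).IsUnimodular := by
  refine ⟨div_pos h.1 (by positivity), ?_⟩
  rw [← h.2]
  simp only [BinForm.dil]
  field_simp

lemma act (h : Q.IsUnimodular) (W : Matrix.SpecialLinearGroup (Fin 2) ℤ) :
    (Q.act W).IsUnimodular := by
  have hdet : (W 0 0 : ℝ) * W 1 1 - W 0 1 * W 1 0 = 1 := by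
    have := W.det_coe
    rw [Matrix.det_fin_two] at this
    exact_mod_cast this
  have hne : (0 : ℝ) < (W 0 0 : ℝ) ^ 2 + (W 1 0 : ℝ) ^ 2 := by
    by_contra! hc
    have h1 : (W 0 0 : ℝ) = 0 := by nlinarith [sq_nonneg (W 0 0 : ℝ), sq_nonneg (W 1 0 : ℝ)]
    have h2 : (W 1 0 : ℝ) = 0 := by nlinarith [sq_nonneg (W 0 0 : ℝ), sq_nonneg (W 1 0 : ℝ)]
    rw [h1, h2] at hdet
    norm_num at hdet
  refine ⟨?_, ?_⟩
  · have h1 := h.sq_add_sq_le (W 0 0) (W 1 0)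
    have h2 := h.c_pos
    have h3 := h.1
    simp only [BinForm.act]
    by_contra! hc
    nlinarith
  · have : (Q.act W).a * (Q.act W).c - (Q.act W).b ^ 2 =
        (Q.a * Q.c - Q.b ^ 2) * ((W 0 0 : ℝ) * W 1 1 - W 0 1 * W 1 0) ^ 2 := by
      simp only [BinForm.act, ev]
      ring
    rw [this, hdet, h.2]
    norm_num

end IsUnimodular

lemma act_mul (Q : BinForm) (U W : Matrix (Fin 2) (Fin 2) ℤ) :
    Q.act (U * W) = (Q.act U).act W := by
  simp only [act, ev, Matrix.mul_apply, Fin.sum_univ_two, mk.injEq]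
  push_cast
  refine ⟨by ring, by ring, by ring⟩

lemma Good.dil {δ : ℝ} {B B' n : ℕ} {Q : BinForm} (h : Good δ B Q) (hn : 1 ≤ n)
    (hB : n * B' ≤ B) : Good δ B' (Q.dil n) := by
  intro m hm1 hm2 x y hxy
  rw [dil_dil, ← Nat.cast_mul]
  exact h (n * m) (Nat.mul_pos hn hm1) ((Nat.mul_le_mul_left n hm2).trans hB) x y hxy

lemma Good.mono {δ : ℝ} {B B' : ℕ} {Q : BinForm} (h : Good δ B Q) (hB : B' ≤ B) : Good δ B' Q :=
  fun m hm1 hm2 => h m hm1 (hm2.trans hB)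

lemma exists_act_bounded {δ : ℝ} (hδ : 0 < δ) {Q : BinForm} (hQ : Q.IsUnimodular)
    (h : ∀ x y : ℤ, (x ≠ 0 ∨ y ≠ 0) → δ ≤ Q.ev x y) :
    ∃ W : Matrix.SpecialLinearGroup (Fin 2) ℤ,
      (Q.act W).a ≤ 2 + δ⁻¹ ∧ (Q.act W).c ≤ 2 + δ⁻¹ := by
  have ha := hQ.1
  let z : UpperHalfPlane := ⟨⟨Q.b / Q.a, 1 / Q.a⟩, by positivity⟩
  obtain ⟨g, hg⟩ := ModularGroup.exists_smul_mem_fd z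
  have him := ModularGroup.three_le_four_mul_im_sq_of_mem_fd hg
  have hre := hg.2
  have hdet : (g 0 0 : ℝ) * g 1 1 - g 0 1 * g 1 0 = 1 := by
    have := g.det_coe
    rw [Matrix.det_fin_two] at this
    exact_mod_cast this
  have hdetz : g 0 0 * g 1 1 - g 0 1 * g 1 0 = 1 := by exact_mod_cast hdet
  set p : ℝ := ((g 0 0 : ℤ) : ℝ) with hp
  set q : ℝ := ((g 0 1 : ℤ) : ℝ) with hq
  set c : ℝ := ((g 1 0 : ℤ) : ℝ) with hc
  set d : ℝ := ((g 1 1 : ℤ) : ℝ) with hd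
  have hδcd : δ ≤ Q.ev d c := h (g 1 1) (g 1 0) (by
    by_contra! hcon
    rw [hcon.1, hcon.2] at hdetz
    norm_num at hdetz)
  have hcd : 0 < Q.ev d c := hδ.trans_le hδcd
  have hz : z.re = Q.b / Q.a ∧ z.im = 1 / Q.a := ⟨rfl, rfl⟩
  set X := (g • z).re with hX
  set Y := (g • z).im with hY
  have hden : (c * (z : ℂ) + d) ≠ 0 := by
    have := UpperHalfPlane.denom_ne_zero (g : GL (Fin 2) ℝ) z
    rwa [ModularGroup.denom_apply] at this
  have hmul : ((g • z : UpperHalfPlane) : ℂ) * (c * (z : ℂ) + d) = p * (z : ℂ) + q := by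
    rw [UpperHalfPlane.coe_specialLinearGroup_apply]
    exact div_mul_cancel₀ _ hden
  have hR := congrArg Complex.re hmul
  have hI := congrArg Complex.im hmul
  simp only [Complex.add_re, Complex.mul_re, Complex.ofReal_re, Complex.ofReal_im,
      Complex.add_im, Complex.mul_im, UpperHalfPlane.coe_re, UpperHalfPlane.coe_im, hz.1, hz.2,
      ← hX, ← hY] at hR hI
  field_simp at hR hI
  have hu := hQ.2
  have hnorm : (c * Q.b + d * Q.a) ^ 2 + c ^ 2 = Q.a * Q.ev d c := by
    simp only [ev]
    linear_combination (-c ^ 2) * hu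
  have hnorm2 : (p * Q.b + q * Q.a) ^ 2 + p ^ 2 = Q.a * Q.ev q p := by
    simp only [ev]
    linear_combination (-p ^ 2) * hu
  have hR' : X * (c * Q.b + d * Q.a) - Y * c = p * Q.b + q * Q.a := by linear_combination hR
  have hI' : X * c + Y * (c * Q.b + d * Q.a) = p := by linear_combination hI
  have hYv : Y * Q.ev d c = 1 := by
    apply mul_left_cancel₀ ha.ne'
    linear_combination (-Y) * hnorm + (c * Q.b + d * Q.a) * hI' - c * hR' + Q.a * hdet
  have hXY : Q.ev q p = (X ^ 2 + Y ^ 2) * Q.ev d c := by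
    apply mul_left_cancel₀ ha.ne'
    rw [← hnorm2, ← hR', ← hI']
    linear_combination (X ^ 2 + Y ^ 2) * hnorm
  have hYpos : 0 < Y := (g • z).im_pos
  have hY1 : Y ≤ δ⁻¹ := by
    rw [le_inv_comm₀ hYpos hδ]
    calc δ ≤ Q.ev d c := hδcd
      _ = Y⁻¹ := eq_inv_of_mul_eq_one_right hYv
  have hY2 : 1 / 2 ≤ Y := by nlinarith
  have hev : Q.ev d c ≤ 2 := by nlinarith
  have hX2 : X ^ 2 ≤ 1 / 4 := by
    have := sq_le_sq' (by linarith [(abs_le.1 hre).1]) (abs_le.1 hre).2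
    linarith
  let W : Matrix.SpecialLinearGroup (Fin 2) ℤ := ⟨!![g 1 1, g 0 1; g 1 0, g 0 0], by
    rw [Matrix.det_fin_two_of]
    linarith⟩
  refine ⟨W, ?_, ?_⟩
  · have : 0 < δ⁻¹ := inv_pos.2 hδ
    change Q.ev d c ≤ _
    linarith
  · change Q.ev q p ≤ _
    rw [hXY]
    have h1 : (X ^ 2 + Y ^ 2) * Q.ev d c = X ^ 2 * Q.ev d c + Y := by
      linear_combination Y * hYv
    have h2 : X ^ 2 * Q.ev d c ≤ 1 / 4 * 2 := mul_le_mul hX2 hev hcd.le (by norm_num)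
    linarith

end BinForm

/-- The discriminant of the characteristic polynomial of a `2 × 2` matrix. -/
def matDisc (J : Matrix (Fin 2) (Fin 2) ℤ) : ℤ := (J 0 0 - J 1 1) ^ 2 + 4 * (J 0 1 * J 1 0)

lemma matDisc_eq (J : Matrix (Fin 2) (Fin 2) ℤ) : matDisc J = J.trace ^ 2 - 4 * J.det := by
  rw [matDisc, Matrix.trace_fin_two, Matrix.det_fin_two]
  ring

lemma isSquare_of_mul_sq_eq {D P x : ℤ} (hP : P ≠ 0) (h : D * P ^ 2 = x ^ 2) : IsSquare D := by
  have h1 : P ^ 2 ∣ x ^ 2 := ⟨D, by linarith⟩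
  obtain ⟨y, rfl⟩ := (Int.pow_dvd_pow_iff two_ne_zero).1 h1
  refine ⟨y, ?_⟩
  have h2 : P ^ 2 * (D - y * y) = 0 := by linear_combination h
  rcases mul_eq_zero.1 h2 with h3 | h3
  · exact absurd (pow_eq_zero_iff two_ne_zero |>.1 h3) hP
  · linarith

lemma det_commutator (J K : Matrix (Fin 2) (Fin 2) ℤ) :
    (J * K - K * J).det = -(J 0 1 * K 1 0 - K 0 1 * J 1 0) ^ 2 -
      ((J 0 0 - J 1 1) * K 0 1 - (K 0 0 - K 1 1) * J 0 1) *
        (J 1 0 * (K 0 0 - K 1 1) - K 1 0 * (J 0 0 - J 1 1)) := by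
  rw [Matrix.det_fin_two]
  simp only [Matrix.sub_apply, Matrix.mul_apply, Fin.sum_univ_two]
  ring

lemma mul_comm_of_det_commutator_eq_zero {J K : Matrix (Fin 2) (Fin 2) ℤ}
    (hJ : ¬ IsSquare (matDisc J)) (h : (J * K - K * J).det = 0) : J * K = K * J := by
  rw [det_commutator] at h
  set P := J 1 0 * (K 0 0 - K 1 1) - K 1 0 * (J 0 0 - J 1 1) with hP
  set S := J 0 1 * K 1 0 - K 0 1 * J 1 0 with hS
  set R := (J 0 0 - J 1 1) * K 0 1 - (K 0 0 - K 1 1) * J 0 1 with hR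
  have hrel : J 1 0 * R + (J 0 0 - J 1 1) * S + J 0 1 * P = 0 := by
    rw [hP, hS, hR]
    ring
  have hP0 : P = 0 := by
    by_contra hP0
    apply hJ
    apply isSquare_of_mul_sq_eq hP0 (x := 2 * J 1 0 * S - (J 0 0 - J 1 1) * P)
    rw [matDisc]
    linear_combination (4 * J 1 0 ^ 2) * h + 4 * J 1 0 * P * hrel
  have hS0 : S = 0 := by
    rw [hP0, mul_zero, sub_zero, neg_eq_zero] at h
    exact pow_eq_zero_iff two_ne_zero |>.1 h
  have hR0 : R = 0 := by
    rw [hP0, hS0, mul_zero, mul_zero, add_zero, add_zero] at hrel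
    refine (mul_eq_zero.1 hrel).resolve_left fun hc => hJ ⟨J 0 0 - J 1 1, ?_⟩
    rw [matDisc, hc]
    ring
  rw [hP] at hP0
  rw [hS] at hS0
  rw [hR] at hR0
  ext i j
  fin_cases i <;> fin_cases j <;>
    simp only [Matrix.mul_apply, Fin.sum_univ_two, Fin.zero_eta, Fin.mk_one, Fin.isValue] <;>
    linarith

lemma dvd_det_commutator {J K : Matrix (Fin 2) (Fin 2) ℤ} {n : ℤ} (hJ : n ∣ J 1 0)
    (hK : n ∣ K 1 0) : n ∣ (J * K - K * J).det := by
  rw [det_commutator]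
  obtain ⟨x, hx⟩ := hJ
  obtain ⟨y, hy⟩ := hK
  rw [hx, hy]
  refine ⟨-n * (J 0 1 * y - K 0 1 * x) ^ 2 - ((J 0 0 - J 1 1) * K 0 1 - (K 0 0 - K 1 1) * J 0 1) *
        (x * (K 0 0 - K 1 1) - y * (J 0 0 - J 1 1)), by ring⟩

lemma abs_det_commutator_le {J K : Matrix (Fin 2) (Fin 2) ℤ} {E : ℤ}
    (hJ : ∀ i j, |J i j| ≤ E) (hK : ∀ i j, |K i j| ≤ E) : |(J * K - K * J).det| ≤ 20 * E ^ 4 := by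
  have hE : 0 ≤ E := (abs_nonneg _).trans (hJ 0 0)
  have key : ∀ x y z w X Y Z W : ℤ, |x| ≤ X → |y| ≤ Y → |z| ≤ Z → |w| ≤ W →
      |x * y - z * w| ≤ X * Y + Z * W := by
    intro x y z w X Y Z W hx hy hz hw
    refine (abs_sub _ _).trans ?_
    rw [abs_mul, abs_mul]
    exact add_le_add (mul_le_mul hx hy (abs_nonneg _) ((abs_nonneg _).trans hx))
      (mul_le_mul hz hw (abs_nonneg _) ((abs_nonneg _).trans hz))
  have hJd : |J 0 0 - J 1 1| ≤ 2 * E := (abs_sub _ _).trans (by linarith [hJ 0 0, hJ 1 1])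
  have hKd : |K 0 0 - K 1 1| ≤ 2 * E := (abs_sub _ _).trans (by linarith [hK 0 0, hK 1 1])
  have h1 := key _ _ _ _ _ _ _ _ (hJ 0 1) (hK 1 0) (hK 0 1) (hJ 1 0)
  have h2 := key _ _ _ _ _ _ _ _ hJd (hK 0 1) hKd (hJ 0 1)
  have h3 := key _ _ _ _ _ _ _ _ (hJ 1 0) hKd (hK 1 0) hJd
  rw [det_commutator, neg_sub_left, abs_neg]
  refine (abs_add_le _ _).trans ?_
  rw [abs_mul, abs_pow]
  have h4 := mul_le_mul h2 h3 (abs_nonneg _) ((abs_nonneg _).trans h2)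
  have h5 := pow_le_pow_left₀ (abs_nonneg _) h1 2
  nlinarith

lemma abs_matDisc_le {J : Matrix (Fin 2) (Fin 2) ℤ} {E : ℤ} (hJ : ∀ i j, |J i j| ≤ E) :
    |matDisc J| ≤ 8 * E ^ 2 := by
  have hE : 0 ≤ E := (abs_nonneg _).trans (hJ 0 0)
  have hJd : |J 0 0 - J 1 1| ≤ 2 * E := (abs_sub _ _).trans (by linarith [hJ 0 0, hJ 1 1])
  rw [matDisc]
  refine (abs_add_le _ _).trans ?_
  rw [abs_mul, abs_mul, abs_pow]
  have h5 := pow_le_pow_left₀ (abs_nonneg _) hJd 2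
  have h6 := mul_le_mul (hJ 0 1) (hJ 1 0) (abs_nonneg _) hE
  rw [sq_abs] at h5 ⊢
  rw [abs_of_pos (by norm_num : (0 : ℤ) < 4)]
  linarith

/-- The integral matrix `m m' D(m') k⁻¹ D(m)⁻¹`, where `D(n) = diag(n⁻¹, n)`. -/
def collMat (k : Matrix.SpecialLinearGroup (Fin 2) ℤ) (m m' : ℤ) : Matrix (Fin 2) (Fin 2) ℤ :=
  !![k 1 1 * m ^ 2, -k 0 1; -(k 1 0 * m ^ 2 * m' ^ 2), k 0 0 * m' ^ 2]

lemma det_SL2 (k : Matrix.SpecialLinearGroup (Fin 2) ℤ) : k 0 0 * k 1 1 - k 0 1 * k 1 0 = 1 := by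
  have := k.det_coe
  rwa [Matrix.det_fin_two] at this

lemma det_collMat (k : Matrix.SpecialLinearGroup (Fin 2) ℤ) (m m' : ℤ) :
    (collMat k m m').det = (m * m') ^ 2 := by
  rw [collMat, Matrix.det_fin_two_of]
  linear_combination (m ^ 2 * m' ^ 2) * det_SL2 k

lemma collMat_not_scalar {k : Matrix.SpecialLinearGroup (Fin 2) ℤ} {m m' : ℤ} (hm : 0 < m)
    (hm' : 0 < m') (hne : m ≠ m') :
    ¬ (collMat k m m' 0 1 = 0 ∧ collMat k m m' 0 0 = collMat k m m' 1 1) := by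
  rintro ⟨h01, h00⟩
  simp only [collMat, Matrix.of_apply, Matrix.cons_val', Matrix.cons_val_one,
    Matrix.cons_val_fin_one, Matrix.cons_val_zero, neg_eq_zero] at h00 h01
  have hd := det_SL2 k
  rw [h01, zero_mul, sub_zero] at hd
  rcases Int.eq_one_or_neg_one_of_mul_eq_one' hd with ⟨h1, h2⟩ | ⟨h1, h2⟩
  · rw [h2, h1] at h00
    exact hne ((sq_eq_sq₀ hm.le hm'.le).1 (by linarith))
  · rw [h2, h1] at h00
    exact hne ((sq_eq_sq₀ hm.le hm'.le).1 (by linarith))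

lemma isSquare_matDisc_zmod_of_comm {k : Matrix.SpecialLinearGroup (Fin 2) ℤ} {p q : ℕ}
    (hp : p.Prime) (hq : q.Prime) (hpq : p ≠ q) {J : Matrix (Fin 2) (Fin 2) ℤ}
    (h : collMat k p q * J = J * collMat k p q) : IsSquare ((matDisc J : ℤ) : ZMod p) := by
  have := Fact.mk hp
  have hp0 : ((p : ℤ) : ZMod p) = 0 := by simp
  have hq0 : ((q : ℤ) : ZMod p) ≠ 0 := by
    intro h0
    have h1 : (q : ZMod p) = 0 := by exact_mod_cast h0
    rw [ZMod.natCast_eq_zero_iff] at h1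
    exact hpq ((Nat.prime_dvd_prime_iff_eq hp hq).1 h1)
  have h00 := congrArg (Int.cast : ℤ → ZMod p) (congrFun (congrFun h 0) 0)
  have h10 := congrArg (Int.cast : ℤ → ZMod p) (congrFun (congrFun h 1) 0)
  have hd := congrArg (Int.cast : ℤ → ZMod p) (det_SL2 k)
  simp only [collMat, Matrix.mul_apply, Fin.sum_univ_two, Matrix.of_apply, Matrix.cons_val_zero,
    Matrix.cons_val_one, Matrix.cons_val', Matrix.cons_val_fin_one] at h00 h10
  push_cast at h00 h10 hd
  have hp0' : (p : ZMod p) = 0 := by simp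
  have hq0' : (q : ZMod p) ≠ 0 := by exact_mod_cast hq0
  rw [hp0'] at h00 h10
  have hb : ((k 0 1 : ℤ) : ZMod p) * (J 1 0 : ZMod p) = 0 := by linear_combination -h00
  have ha : ((k 0 0 : ℤ) : ZMod p) * (J 1 0 : ZMod p) = 0 := by
    have : (q : ZMod p) ^ 2 * (((k 0 0 : ℤ) : ZMod p) * (J 1 0 : ZMod p)) = 0 := by
      linear_combination h10
    exact (mul_eq_zero.1 this).resolve_left (pow_ne_zero 2 hq0')
  have hc : (J 1 0 : ZMod p) = 0 := by
    linear_combination (k 1 1 : ZMod p) * ha - (k 1 0 : ZMod p) * hb - (J 1 0 : ZMod p) * hd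
  refine ⟨(J 0 0 : ZMod p) - J 1 1, ?_⟩
  rw [matDisc]
  push_cast
  rw [hc]
  ring

lemma two_pow_dvd_or_of_four_pow_dvd_mul {x y : ℤ} {w : ℕ} (h : (4 : ℤ) ^ w ∣ x * y) :
    (2 : ℤ) ^ w ∣ x ∨ (2 : ℤ) ^ w ∣ y := by
  have h4 : (4 : ℤ) ^ w = 2 ^ (w + w) := by
    rw [← two_mul, pow_mul]
    norm_num
  rw [h4] at h
  by_cases hx : (2 : ℤ) ^ w ∣ x
  · exact Or.inl hx
  · right
    obtain ⟨d₁, d₂, h1, h2, h3⟩ := exists_dvd_and_dvd_of_dvd_mul h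
    have hd1 : d₁ ∣ 2 ^ (w + w) := ⟨d₂, h3⟩
    obtain ⟨i, hi, hi'⟩ := (dvd_prime_pow Int.prime_two _).1 hd1
    have hiw : i < w := by
      by_contra! hcon
      exact hx ((pow_dvd_pow 2 hcon).trans (hi'.symm.dvd.trans h1))
    refine Dvd.dvd.trans ?_ h2
    have h5 : (2 : ℤ) ^ (w + w) ∣ 2 ^ i * d₂ := by
      rw [h3]
      exact mul_dvd_mul_right hi'.dvd _
    have h6 : w + w = i + (w + w - i) := by omega
    rw [h6, pow_add] at h5
    have h7 := (mul_dvd_mul_iff_left (pow_ne_zero i (two_ne_zero' ℤ))).1 h5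
    exact (pow_dvd_pow 2 (by omega)).trans h7

namespace BinForm

/-- `k` realises a `4 ^ v`-congruence between the dilations of `Q` by `m` and `m'`. -/
def Coll (Q : BinForm) (v m m' : ℕ) (k : Matrix.SpecialLinearGroup (Fin 2) ℤ) : Prop :=
  (4 : ℤ) ^ v ∣ k 1 0 ∧ ∀ x y : ℝ, (Q.dil m').ev x y ≤ 2 * ((Q.dil m).act k).ev x y

variable {Q : BinForm} {v m m' : ℕ} {k : Matrix.SpecialLinearGroup (Fin 2) ℤ}

lemma Coll.ev_act_collMat_le (h : Q.Coll v m m' k) (hm : 0 < m) (hm' : 0 < m') (x y : ℝ) :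
    (Q.act (collMat k m m')).ev x y ≤ 2 * ((m : ℝ) * m') ^ 2 * Q.ev x y := by
  have hm0 : (m : ℝ) ≠ 0 := by positivity
  have hm0' : (m' : ℝ) ≠ 0 := by positivity
  have hd : (k 0 0 : ℝ) * k 1 1 - k 0 1 * k 1 0 = 1 := by exact_mod_cast det_SL2 k
  rw [ev_act]
  simp only [collMat, Matrix.of_apply, Matrix.cons_val', Matrix.cons_val_one,
    Matrix.cons_val_fin_one, Matrix.cons_val_zero]
  push_cast
  set X : ℝ := (k 1 1 : ℝ) * m ^ 2 * x + -(k 0 1 : ℝ) * y with hX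
  set Y : ℝ := -((k 1 0 : ℝ) * m ^ 2 * m' ^ 2) * x + (k 0 0 : ℝ) * m' ^ 2 * y with hY
  have h1 := h.2 (m' * X) (Y / m')
  rw [ev_dil _ hm0', ev_act, ev_dil _ hm0] at h1
  have e1 : (m' : ℝ) * X / m' = X := by field_simp
  have e2 : (m' : ℝ) * (Y / m') = Y := by field_simp
  have e3 : ((k 0 0 : ℝ) * (m' * X) + k 0 1 * (Y / m')) / m = (m * m' : ℝ) * x := by
    rw [hX, hY]
    field_simp
    linear_combination (m ^ 2 * x) * hd
  have e4 : (m : ℝ) * ((k 1 0 : ℝ) * (m' * X) + k 1 1 * (Y / m')) = (m * m' : ℝ) * y := by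
    rw [hX, hY]
    field_simp
    linear_combination y * hd
  rw [e1, e2, e3, e4, ev_mul] at h1
  linarith

lemma abs_conj_le (hQ : Q.IsUnimodular) {C s : ℕ} {J : Matrix (Fin 2) (Fin 2) ℤ}
    (hJ : ∀ x y : ℝ, (Q.act J).ev x y ≤ 2 * (s : ℝ) ^ 2 * Q.ev x y)
    {W : Matrix.SpecialLinearGroup (Fin 2) ℤ} (ha : (Q.act W).a ≤ C) (hc : (Q.act W).c ≤ C) :
    ∀ i j, |((W⁻¹ : Matrix.SpecialLinearGroup (Fin 2) ℤ).1 * J * W.1) i j| ≤ 2 * C * s := by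
  set G := (W⁻¹ : Matrix.SpecialLinearGroup (Fin 2) ℤ).1 * J * W.1 with hG
  have hW : W.1 * G = J * W.1 := by
    rw [hG, ← mul_assoc, ← mul_assoc, ← Matrix.SpecialLinearGroup.coe_mul, mul_inv_cancel,
      Matrix.SpecialLinearGroup.coe_one, one_mul]
  have hU := hQ.act W
  have hC : (0 : ℝ) ≤ C := C.cast_nonneg
  have key : ∀ x y : ℝ, (Q.act W).ev x y ≤ C →
      (G 0 0 * x + G 0 1 * y) ^ 2 + (G 1 0 * x + G 1 1 * y) ^ 2 ≤ (2 * C * s) ^ 2 := by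
    intro x y hxy
    have h1 := hU.sq_add_sq_le (G 0 0 * x + G 0 1 * y) (G 1 0 * x + G 1 1 * y)
    have h2 : (Q.act W).ev (G 0 0 * x + G 0 1 * y) (G 1 0 * x + G 1 1 * y) ≤
        2 * (s : ℝ) ^ 2 * C := by
      rw [← ev_act, ← act_mul, hW, act_mul, ev_act]
      refine (hJ _ _).trans (mul_le_mul_of_nonneg_left ?_ (by positivity))
      rwa [ev_act] at hxy
    calc _ ≤ _ := h1
      _ ≤ (C + C) * (2 * (s : ℝ) ^ 2 * C) :=
        mul_le_mul (add_le_add ha hc) h2 (hU.ev_nonneg _ _) (by positivity)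
      _ = _ := by ring
  have h0 := key 1 0 (by simpa [ev] using ha)
  have h1 := key 0 1 (by simpa [ev] using hc)
  simp only [mul_one, mul_zero, add_zero, zero_add] at h0 h1
  have fin : ∀ g : ℤ, (g : ℝ) ^ 2 ≤ (2 * C * s) ^ 2 → |g| ≤ 2 * C * s := by
    intro g hg
    have := abs_le_of_sq_le_sq hg (by positivity)
    exact_mod_cast this
  intro i j
  fin_cases i <;> fin_cases j
  · exact fin (G 0 0) (by nlinarith [sq_nonneg (G 1 0 : ℝ)])
  · exact fin (G 0 1) (by nlinarith [sq_nonneg (G 1 1 : ℝ)])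
  · exact fin (G 1 0) (by nlinarith [sq_nonneg (G 0 0 : ℝ)])
  · exact fin (G 1 1) (by nlinarith [sq_nonneg (G 0 1 : ℝ)])

lemma matDisc_conj (J : Matrix (Fin 2) (Fin 2) ℤ) (W : Matrix.SpecialLinearGroup (Fin 2) ℤ) :
    matDisc ((W⁻¹ : Matrix.SpecialLinearGroup (Fin 2) ℤ).1 * J * W.1) = matDisc J := by
  rw [matDisc_eq, matDisc_eq, Matrix.trace_mul_comm, ← mul_assoc, Matrix.det_mul, Matrix.det_mul,
    ← Matrix.SpecialLinearGroup.coe_mul, mul_inv_cancel, Matrix.SpecialLinearGroup.coe_one, one_mul]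
  simp [-Matrix.SpecialLinearGroup.coe_inv]

lemma det_commutator_conj (J K : Matrix (Fin 2) (Fin 2) ℤ)
    (W : Matrix.SpecialLinearGroup (Fin 2) ℤ) :
    (((W⁻¹ : Matrix.SpecialLinearGroup (Fin 2) ℤ).1 * J * W.1) *
      ((W⁻¹ : Matrix.SpecialLinearGroup (Fin 2) ℤ).1 * K * W.1) -
      ((W⁻¹ : Matrix.SpecialLinearGroup (Fin 2) ℤ).1 * K * W.1) *
      ((W⁻¹ : Matrix.SpecialLinearGroup (Fin 2) ℤ).1 * J * W.1)).det = (J * K - K * J).det := by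
  have hW : W.1 * (W⁻¹ : Matrix.SpecialLinearGroup (Fin 2) ℤ).1 = 1 := by
    rw [← Matrix.SpecialLinearGroup.coe_mul, mul_inv_cancel, Matrix.SpecialLinearGroup.coe_one]
  set U := (W⁻¹ : Matrix.SpecialLinearGroup (Fin 2) ℤ).1 with hU
  have h : ∀ A B : Matrix (Fin 2) (Fin 2) ℤ, U * A * W.1 * (U * B * W.1) = U * (A * B) * W.1 := by
    intro A B
    calc _ = U * A * (W.1 * U) * B * W.1 := by simp only [mul_assoc]
      _ = _ := by rw [hW]; simp only [mul_assoc, one_mul]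
  rw [h, h, ← sub_mul, ← mul_sub, Matrix.det_mul, Matrix.det_mul, hU]
  simp [-Matrix.SpecialLinearGroup.coe_inv]

lemma Coll.not_isSquare_matDisc {δ : ℝ} {T C w B : ℕ} (hQ : Q.IsUnimodular)
    (hG : Good δ B Q) (hB : 2 ^ w ≤ B) {W : Matrix.SpecialLinearGroup (Fin 2) ℤ}
    (ha : (Q.act W).a ≤ C) (hc : (Q.act W).c ≤ C) (h : Q.Coll (2 * w) m m' k) (hm : 0 < m)
    (hm' : 0 < m') (hne : m ≠ m') (hmT : m ≤ T) (hmT' : m' ≤ T)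
    (hbig : 6 * C * (T : ℝ) ^ 8 < δ * 4 ^ w) : ¬ IsSquare (matDisc (collMat k m m')) := by
  rintro ⟨s, hs⟩
  set J := collMat k m m' with hJ
  have hdet : J.det = ((m : ℤ) * m') ^ 2 := det_collMat k m m'
  have hev := h.ev_act_collMat_le hm hm'
  obtain ⟨l₁, l₂, hadd, hmul⟩ : ∃ l₁ l₂ : ℤ, l₁ + l₂ = J 0 0 + J 1 1 ∧ l₁ * l₂ = J.det := by
    have h1 : s * s = (J 0 0 + J 1 1) ^ 2 - 4 * J.det := by
      rw [← hs, matDisc_eq, Matrix.trace_fin_two]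
    have h2 : (2 : ℤ) ∣ (J 0 0 + J 1 1) - s := by
      have h3 : Even ((J 0 0 + J 1 1 - s) * (J 0 0 + J 1 1 + s)) := ⟨2 * J.det, by linarith⟩
      rcases Int.even_mul.1 h3 with h4 | h4
      · exact h4.two_dvd
      · have : J 0 0 + J 1 1 - s = (J 0 0 + J 1 1 + s) - 2 * s := by ring
        rw [this]
        exact dvd_sub h4.two_dvd (dvd_mul_right _ _)
    obtain ⟨l, hl⟩ := h2
    refine ⟨l, l + s, by linarith, ?_⟩
    have h5 : s = J 0 0 + J 1 1 - 2 * l := by linarith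
    rw [h5] at h1 ⊢
    linarith
  have hprod : (J 1 1 - l₁) * (J 1 1 - l₂) = -(J 0 1 * J 1 0) := by
    have h1 := Matrix.det_fin_two J
    linear_combination (-J 1 1) * hadd + hmul + h1
  have hJ10 : (4 : ℤ) ^ (2 * w) ∣ J 1 0 := by
    have : J 1 0 = -(k 1 0 * (m : ℤ) ^ 2 * (m' : ℤ) ^ 2) := by simp [hJ, collMat]
    rw [this, mul_assoc]
    exact (h.1.mul_right _).neg_right
  have hsplit : (4 : ℤ) ^ (2 * w) ∣ (J 1 1 - l₁) * (J 1 1 - l₂) := by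
    rw [hprod]
    exact (hJ10.mul_left _).neg_right
  have h24 : (2 : ℤ) ^ (2 * w) = 4 ^ w := by
    rw [pow_mul]
    norm_num
  obtain ⟨l, hl, hldvd⟩ : ∃ l : ℤ, (4 : ℤ) ^ w ∣ J 1 1 - l ∧ l ∣ J.det := by
    rcases two_pow_dvd_or_of_four_pow_dvd_mul hsplit with h1 | h1
    · exact ⟨l₁, h24 ▸ h1, ⟨l₂, hmul.symm⟩⟩
    · exact ⟨l₂, h24 ▸ h1, ⟨l₁, by linarith⟩⟩
  have hlT : |(l : ℝ)| ≤ (T : ℝ) ^ 4 := by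
    have h1 : |l| ≤ ((m : ℤ) * m') ^ 2 := by
      rw [hdet] at hldvd
      exact Int.le_of_dvd (by positivity) ((abs_dvd _ _).2 hldvd)
    have h2 : ((m : ℝ) * m') ^ 2 ≤ (T : ℝ) ^ 4 := by
      have : (m : ℝ) * m' ≤ (T : ℝ) * T := by gcongr
      calc _ ≤ ((T : ℝ) * T) ^ 2 := by gcongr
        _ = _ := by ring
    refine le_trans ?_ h2
    exact_mod_cast h1
  have hmm : ((m : ℝ) * m') ^ 2 ≤ (T : ℝ) ^ 4 := by
    have : (m : ℝ) * m' ≤ (T : ℝ) * T := by gcongr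
    calc _ ≤ ((T : ℝ) * T) ^ 2 := by gcongr
      _ = _ := by ring
  have hT1 : (1 : ℝ) ≤ T := by exact_mod_cast hm.trans_le hmT
  have key : ∀ u v : ℤ, Q.ev u v ≤ C → (J 0 0 - l) * u + J 0 1 * v = 0 ∧
      J 1 0 * u + (J 1 1 - l) * v = 0 := by
    intro u v huv
    by_contra hcon
    set g₀ := (J 0 0 - l) * u + J 0 1 * v with hg₀
    set g₁ := J 1 0 * u + (J 1 1 - l) * v with hg₁
    have hg₁dvd : (4 : ℤ) ^ w ∣ g₁ := by
      refine dvd_add (Dvd.dvd.mul_right ?_ _) (hl.mul_right _)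
      exact (pow_dvd_pow 4 (by omega)).trans hJ10
    obtain ⟨z, hz⟩ := hg₁dvd
    have hpos := hG (2 ^ w) Nat.one_le_two_pow hB g₀ z (by
      by_contra! hc2
      apply hcon
      rw [hz, hc2.2, mul_zero]
      exact ⟨hc2.1, rfl⟩)
    have hval : Q.ev g₀ g₁ = 4 ^ w * (Q.dil ((2 ^ w : ℕ) : ℝ)).ev g₀ z := by
      have h2w : ((2 ^ w : ℕ) : ℝ) ≠ 0 := by positivity
      rw [ev_dil _ h2w, hz]
      have h4 : (4 : ℝ) ^ w = (2 ^ w) ^ 2 := by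
        rw [← pow_mul, mul_comm, pow_mul]
        norm_num
      rw [h4, ← ev_mul]
      push_cast
      congr 1
      · field_simp
      · have h4' : (4 : ℝ) ^ w = (2 ^ w) ^ 2 := h4
        rw [h4']
        ring
    have hup : Q.ev g₀ g₁ ≤ 6 * C * (T : ℝ) ^ 8 := by
      have e1 : Q.ev g₀ g₁ = Q.ev ((J 0 0 * u + J 0 1 * v : ℝ) + (-l : ℝ) * u)
          ((J 1 0 * u + J 1 1 * v : ℝ) + (-l : ℝ) * v) := by
        rw [hg₀, hg₁]
        push_cast
        congr 1 <;> ring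
      rw [e1]
      refine (hQ.ev_add_le _ _ _ _).trans ?_
      rw [ev_mul, ← ev_act]
      have e2 := hev u v
      have e3 : 2 * ((m : ℝ) * m') ^ 2 * Q.ev u v ≤ 2 * (T : ℝ) ^ 4 * C :=
        mul_le_mul (by linarith) huv (hQ.ev_nonneg _ _) (by positivity)
      have e4 : (-(l : ℝ)) ^ 2 * Q.ev u v ≤ ((T : ℝ) ^ 4) ^ 2 * C := by
        apply mul_le_mul _ huv (hQ.ev_nonneg _ _) (by positivity)
        rw [neg_sq, ← sq_abs]
        exact pow_le_pow_left₀ (abs_nonneg _) hlT 2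
      have e5 : (T : ℝ) ^ 4 * C ≤ (T : ℝ) ^ 8 * C := by
        apply mul_le_mul_of_nonneg_right _ C.cast_nonneg
        exact pow_le_pow_right₀ hT1 (by norm_num)
      have e6 : ((T : ℝ) ^ 4) ^ 2 = (T : ℝ) ^ 8 := by ring
      rw [e6] at e4
      linarith
    have h4w : (0 : ℝ) < 4 ^ w := by positivity
    nlinarith
  have k0 := key (W 0 0) (W 1 0) ha
  have k1 := key (W 0 1) (W 1 1) hc
  have hdW := det_SL2 W
  have z00 : J 0 0 - l = 0 := by
    linear_combination W 1 1 * k0.1 - W 1 0 * k1.1 - (J 0 0 - l) * hdW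
  have z01 : J 0 1 = 0 := by
    linear_combination W 0 0 * k1.1 - W 0 1 * k0.1 - J 0 1 * hdW
  have z11 : J 1 1 - l = 0 := by
    linear_combination W 0 0 * k1.2 - W 0 1 * k0.2 - (J 1 1 - l) * hdW
  exact collMat_not_scalar (by exact_mod_cast hm) (by exact_mod_cast hm')
    (by exact_mod_cast hne) ⟨z01, by linarith⟩

end BinForm

namespace BinForm

variable {Q : BinForm} {v m m' : ℕ} {k : Matrix.SpecialLinearGroup (Fin 2) ℤ}

lemma Coll.abs_conj_collMat_le (hQ : Q.IsUnimodular) {C T : ℕ}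
    {W : Matrix.SpecialLinearGroup (Fin 2) ℤ} (ha : (Q.act W).a ≤ C) (hc : (Q.act W).c ≤ C)
    (h : Q.Coll v m m' k) (hm : 0 < m) (hm' : 0 < m') (hmT : m ≤ T) (hmT' : m' ≤ T) (i j) :
    |((W⁻¹ : Matrix.SpecialLinearGroup (Fin 2) ℤ).1 * collMat k m m' * W.1) i j| ≤
      2 * C * (T : ℤ) ^ 2 := by
  have h1 := abs_conj_le hQ (C := C) (s := m * m') (J := collMat k m m')
    (by push_cast; exact h.ev_act_collMat_le hm hm') ha hc i j
  refine h1.trans ?_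
  have h2 : ((m * m' : ℕ) : ℤ) ≤ (T : ℤ) ^ 2 := by
    rw [sq]
    exact_mod_cast Nat.mul_le_mul hmT hmT'
  exact mul_le_mul_of_nonneg_left h2 (by positivity)

lemma Coll.isSquare_zmod_matDisc {k₀ : Matrix.SpecialLinearGroup (Fin 2) ℤ}
    {p q T C m₀ m₀' : ℕ} (hQ : Q.IsUnimodular)
    {W : Matrix.SpecialLinearGroup (Fin 2) ℤ} (ha : (Q.act W).a ≤ C) (hc : (Q.act W).c ≤ C)
    (h₀ : Q.Coll v m₀ m₀' k₀) (hm : 0 < m₀) (hm' : 0 < m₀') (hmT : m₀ ≤ T) (hmT' : m₀' ≤ T)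
    (hns : ¬ IsSquare (matDisc (collMat k₀ m₀ m₀')))
    (h : Q.Coll v p q k) (hp : p.Prime) (hq : q.Prime) (hpT : p ≤ T) (hqT : q ≤ T) (hpq : p ≠ q)
    (hbig : 320 * C ^ 4 * T ^ 8 < 4 ^ v) :
    IsSquare ((matDisc (collMat k₀ m₀ m₀') : ℤ) : ZMod p) := by
  apply isSquare_matDisc_zmod_of_comm hp hq hpq (k := k)
  have hdvd : ∀ {m m' : ℕ} {k : Matrix.SpecialLinearGroup (Fin 2) ℤ}, Q.Coll v m m' k →
      (4 : ℤ) ^ v ∣ collMat k m m' 1 0 := by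
    intro m m' k hk
    simp only [collMat, Matrix.of_apply, Matrix.cons_val', Matrix.cons_val_one,
      Matrix.cons_val_fin_one, Matrix.cons_val_zero, dvd_neg]
    rw [mul_assoc]
    exact hk.1.mul_right _
  refine (mul_comm_of_det_commutator_eq_zero hns ?_).symm
  apply Int.eq_zero_of_abs_lt_dvd (dvd_det_commutator (hdvd h₀) (hdvd h))
  rw [← det_commutator_conj _ _ W]
  refine (abs_det_commutator_le (h₀.abs_conj_collMat_le hQ ha hc hm hm' hmT hmT')
    (h.abs_conj_collMat_le hQ ha hc hp.pos hq.pos hpT hqT)).trans_lt ?_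
  have : ((320 * C ^ 4 * T ^ 8 : ℕ) : ℤ) < ((4 ^ v : ℕ) : ℤ) := by exact_mod_cast hbig
  push_cast at this
  calc _ = 320 * (C : ℤ) ^ 4 * (T : ℤ) ^ 8 := by ring
    _ < _ := this

/-- Many odd dilations which are pairwise not congruent modulo a power of `4`. -/
lemma exists_separated {δ : ℝ} (hδ : 0 < δ) : ∃ L t₁ K : ℕ, 0 < L ∧ ∀ t ≥ t₁, ∃ B : ℕ, ∀ Q : BinForm,
    Q.IsUnimodular → Good δ B Q → ∃ S : Finset ℕ, (∀ m ∈ S, Odd m ∧ m ≤ 2 ^ (K * t)) ∧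
      2 ^ t ≤ S.card ∧ ∀ m ∈ S, ∀ m' ∈ S, m ≠ m' → ∀ k, ¬ Q.Coll (L * t) m m' k := by
  classical
  obtain ⟨K₁, n₀, hP⟩ := exists_many_inert_primes
  obtain ⟨C, hC⟩ := exists_nat_ge (2 + δ⁻¹)
  obtain ⟨X, hX⟩ := exists_nat_gt (6 * C / δ)
  set K := 6 * K₁ + 2 with hK
  refine ⟨2 * (4 * K + 1), 1 + n₀ + X + 320 * C ^ 4 + 512 * C ^ 2, K, by omega, fun t ht =>
    ⟨2 ^ ((4 * K + 1) * t), fun Q hQ hG => ?_⟩⟩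
  have htt : t < 2 ^ t := Nat.lt_two_pow_self
  obtain ⟨W, ha, hc⟩ := exists_act_bounded hδ hQ (fun x y hxy => by
    have := hG 1 le_rfl Nat.one_le_two_pow x y hxy
    rwa [Nat.cast_one, dil_one] at this)
  replace ha := ha.trans hC
  replace hc := hc.trans hC
  set T := 2 ^ (K * t) with hT
  have h24 : ∀ n : ℕ, (4 : ℕ) ^ n = 2 ^ (2 * n) := fun n => by rw [pow_mul]; norm_num
  have hbig₁ : 320 * C ^ 4 * T ^ 8 < 4 ^ (2 * (4 * K + 1) * t) := by
    have e : (4 : ℕ) ^ (2 * (4 * K + 1) * t) = 2 ^ ((8 * K + 4) * t) * T ^ 8 := by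
      rw [hT, h24, ← pow_mul, ← pow_add]
      congr 1
      ring
    rw [e]
    apply Nat.mul_lt_mul_of_pos_right _ (by positivity)
    have h1 : 2 ^ t ≤ 2 ^ ((8 * K + 4) * t) :=
      Nat.pow_le_pow_right two_pos (Nat.le_mul_of_pos_left _ (by positivity))
    omega
  have hbig₂ : 6 * C * (T : ℝ) ^ 8 < δ * 4 ^ ((4 * K + 1) * t) := by
    have e : (4 : ℝ) ^ ((4 * K + 1) * t) = 4 ^ t * (T : ℝ) ^ 8 := by
      have : (4 : ℕ) ^ ((4 * K + 1) * t) = 4 ^ t * T ^ 8 := by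
        rw [hT, h24, h24, ← pow_mul, ← pow_add]
        congr 1
        ring
      exact_mod_cast this
    have h1 : (X : ℝ) ≤ 4 ^ t := by
      have h2 : 2 ^ t ≤ 4 ^ t := Nat.pow_le_pow_left (by norm_num) t
      have h3 : X ≤ 4 ^ t := by omega
      exact_mod_cast h3
    rw [e, ← mul_assoc]
    apply mul_lt_mul_of_pos_right _ (by positivity)
    rw [div_lt_iff₀ hδ] at hX
    nlinarith
  have ht1 : 1 ≤ t := by omega
  by_cases hcol : ∃ m₀ m₀' : ℕ, ∃ k₀, (Odd m₀ ∧ m₀ ≤ 2 ^ (t + 1)) ∧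
      (Odd m₀' ∧ m₀' ≤ 2 ^ (t + 1)) ∧ m₀ ≠ m₀' ∧ Q.Coll (2 * (4 * K + 1) * t) m₀ m₀' k₀
  · obtain ⟨m₀, m₀', k₀, ⟨ho, hmT⟩, ⟨ho', hmT'⟩, hne, h₀⟩ := hcol
    have hTT : 2 ^ (t + 1) ≤ T := by
      apply Nat.pow_le_pow_right two_pos
      rw [hK]
      nlinarith
    have h₀' : Q.Coll (2 * ((4 * K + 1) * t)) m₀ m₀' k₀ := mul_assoc 2 (4 * K + 1) t ▸ h₀
    have hns := h₀'.not_isSquare_matDisc hQ hG le_rfl ha hc ho.pos ho'.pos hne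
      (hmT.trans hTT) (hmT'.trans hTT) hbig₂
    set D := matDisc (collMat k₀ m₀ m₀') with hD
    have hDn : |D| ≤ ((2 ^ (6 * t) : ℕ) : ℤ) := by
      rw [hD, ← matDisc_conj _ W]
      refine (abs_matDisc_le
        (h₀.abs_conj_collMat_le hQ ha hc ho.pos ho'.pos hmT hmT')).trans ?_
      have h1 : 512 * C ^ 2 ≤ 2 ^ (2 * t) := by
        have : 2 ^ t ≤ 2 ^ (2 * t) := Nat.pow_le_pow_right two_pos (by omega)
        omega
      have h2 : 8 * (2 * C * (2 ^ (t + 1)) ^ 2) ^ 2 ≤ 2 ^ (6 * t) := by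
        calc _ = 512 * C ^ 2 * 2 ^ (4 * t) := by ring
          _ ≤ 2 ^ (2 * t) * 2 ^ (4 * t) := Nat.mul_le_mul_right _ h1
          _ = _ := by rw [← pow_add]; congr 1; ring
      exact_mod_cast h2
    have h1t : 2 ^ t ≤ 2 ^ (6 * t) := Nat.pow_le_pow_right two_pos (by omega)
    have hcard := hP (2 ^ (6 * t)) (by omega) D hns hDn
    have hnT : (2 ^ (6 * t)) ^ K₁ ≤ T := by
      rw [← pow_mul]
      apply Nat.pow_le_pow_right two_pos
      rw [hK]
      nlinarith
    refine ⟨_, ?_, h1t.trans hcard, ?_⟩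
    · intro p hp
      rw [Finset.mem_filter, Nat.mem_primesLE] at hp
      exact ⟨hp.1.2.odd_of_ne_two hp.2.1, hp.1.1.trans hnT⟩
    · intro p hp q hq hpq k hk
      rw [Finset.mem_filter, Nat.mem_primesLE] at hp hq
      exact hp.2.2 (h₀.isSquare_zmod_matDisc hQ ha hc ho.pos ho'.pos (hmT.trans hTT)
        (hmT'.trans hTT) hns hk hp.1.2 hq.1.2 (hp.1.1.trans hnT) (hq.1.1.trans hnT) hpq hbig₁)
  · refine ⟨(Finset.range (2 ^ t)).image fun i => 2 * i + 1, ?_, ?_, ?_⟩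
    · intro m hm
      obtain ⟨i, hi, rfl⟩ := Finset.mem_image.1 hm
      rw [Finset.mem_range] at hi
      refine ⟨⟨i, rfl⟩, ?_⟩
      have : 2 ^ (t + 1) ≤ 2 ^ (K * t) := by
        apply Nat.pow_le_pow_right two_pos
        rw [hK]
        nlinarith
      rw [pow_succ] at this
      omega
    · rw [Finset.card_image_of_injective _ fun i j hij => by simpa using hij, Finset.card_range]
    · intro m hm m' hm' hne k hk
      obtain ⟨i, hi, rfl⟩ := Finset.mem_image.1 hm
      obtain ⟨i', hi', rfl⟩ := Finset.mem_image.1 hm'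
      rw [Finset.mem_range] at hi hi'
      exact hcol ⟨_, _, k, ⟨⟨i, rfl⟩, by rw [pow_succ]; omega⟩, ⟨⟨i', rfl⟩, by rw [pow_succ]; omega⟩,
        hne, hk⟩

end BinForm

open Classical in
/-- In a finite set refined by a sequence of nested equivalence relations, each refining step
splitting a class in at most four parts, some element sees many proper splittings. -/
lemma exists_card_le_four_pow {α : Type*} {E : ℕ → α → α → Prop}
    (hsymm : ∀ v x y, E v x y → E v y x) (htrans : ∀ v x y z, E v x y → E v y z → E v x z)
    (r v : ℕ) (S : Finset α) (hS : S.Nonempty) (hE : ∀ x ∈ S, ∀ y ∈ S, E v x y)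
    (hsplit : ∀ i, ∀ z ∈ S, ∃ g : α → ZMod 4, ∀ x ∈ S, ∀ y ∈ S, E i x z → E i y z →
      g x = g y → E (i + 1) x y)
    (heq : ∀ x ∈ S, ∀ y ∈ S, E (v + r) x y → x = y) :
    ∃ x ∈ S, S.card ≤ 4 ^ ∑ i ∈ Finset.range r,
      if ∃ y ∈ S, E (v + i) x y ∧ ¬ E (v + i + 1) x y then 1 else 0 := by
  induction r generalizing v S with
  | zero =>
    obtain ⟨x, hx⟩ := hS
    refine ⟨x, hx, ?_⟩
    rw [Finset.range_zero, Finset.sum_empty, pow_zero, Finset.card_le_one]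
    exact fun a ha b hb => heq a ha b hb (hE a ha b hb)
  | succ r ih =>
    have hshift : ∀ x, ∀ S' ⊆ S, (∑ i ∈ Finset.range r,
        if ∃ y ∈ S', E (v + 1 + i) x y ∧ ¬ E (v + 1 + i + 1) x y then 1 else 0) ≤
        ∑ i ∈ Finset.range r,
          if ∃ y ∈ S, E (v + (i + 1)) x y ∧ ¬ E (v + (i + 1) + 1) x y then 1 else 0 := by
      intro x S' hS'
      apply Finset.sum_le_sum
      intro i _
      rw [show v + 1 + i = v + (i + 1) by ring]
      split_ifs with h1 h2
      · exact le_rfl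
      · obtain ⟨y, hy, hy'⟩ := h1
        exact absurd ⟨y, hS' hy, hy'⟩ h2
      · exact Nat.zero_le _
      · exact le_rfl
    by_cases hall : ∀ x ∈ S, ∀ y ∈ S, E (v + 1) x y
    · obtain ⟨x, hx, hcard⟩ := ih (v + 1) S hS hall hsplit
        (fun x hx y hy h => heq x hx y hy (by rwa [show v + (r + 1) = v + 1 + r by ring]))
      refine ⟨x, hx, hcard.trans (Nat.pow_le_pow_right (by norm_num) ?_)⟩
      rw [Finset.sum_range_succ']
      exact (hshift x S subset_rfl).trans (Nat.le_add_right _ _)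
    · push Not at hall
      obtain ⟨x₀, hx₀, y₀, hy₀, hxy⟩ := hall
      obtain ⟨g, hg⟩ := hsplit v x₀ hx₀
      obtain ⟨c, -, hc⟩ := Finset.exists_max_image (Finset.univ : Finset (ZMod 4))
        (fun c => (S.filter fun x => g x = c).card) ⟨0, Finset.mem_univ _⟩
      set S' := S.filter fun x => g x = c with hS'
      have hsub : S' ⊆ S := Finset.filter_subset _ _
      have hcard : S.card ≤ 4 * S'.card := by
        rw [Finset.card_eq_sum_card_fiberwise (f := g) (t := Finset.univ)
          (fun x _ => Finset.mem_coe.2 (Finset.mem_univ _))]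
        refine (Finset.sum_le_card_nsmul _ _ _ hc).trans ?_
        simp
      have hne : S'.Nonempty := by
        rw [← Finset.card_pos]
        have := hS.card_pos
        omega
      obtain ⟨x, hx, hx'⟩ := ih (v + 1) S' hne (fun x hx y hy => by
          rw [hS', Finset.mem_filter] at hx hy
          exact hg x hx.1 y hy.1 (hE x hx.1 x₀ hx₀) (hE y hy.1 x₀ hx₀) (hx.2.trans hy.2.symm))
        (fun i z hz => by
          obtain ⟨g, hg⟩ := hsplit i z (hsub hz)
          exact ⟨g, fun x hx y hy => hg x (hsub hx) y (hsub hy)⟩)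
        (fun x hx y hy h => heq x (hsub hx) y (hsub hy)
          (by rwa [show v + (r + 1) = v + 1 + r by ring]))
      refine ⟨x, hsub hx, hcard.trans ?_⟩
      rw [Finset.sum_range_succ', pow_add, mul_comm]
      apply Nat.mul_le_mul (hx'.trans (Nat.pow_le_pow_right (by norm_num) (hshift x S' hsub)))
      have hb : ∃ y ∈ S, E (v + 0) x y ∧ ¬ E (v + 0 + 1) x y := by
        by_contra! hcon
        have h1 := hcon x₀ hx₀ (hE x (hsub hx) x₀ hx₀)
        have h2 := hcon y₀ hy₀ (hE x (hsub hx) y₀ hy₀)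
        exact hxy (htrans _ _ _ _ (hsymm _ _ _ h1) h2)
      rw [if_pos hb]
      norm_num

namespace BinForm

lemma act_one (Q : BinForm) : Q.act 1 = Q := by
  simp [act, ev]

lemma act_mul_inv (Q : BinForm) (W : Matrix.SpecialLinearGroup (Fin 2) ℤ) :
    (Q.act W).act (W⁻¹ : Matrix.SpecialLinearGroup (Fin 2) ℤ) = Q := by
  rw [← act_mul, ← Matrix.SpecialLinearGroup.coe_mul, mul_inv_cancel,
    Matrix.SpecialLinearGroup.coe_one, act_one]

lemma ev_act_le {A A' : BinForm} {H : ℝ} (h : ∀ x y : ℝ, A'.ev x y ≤ H * A.ev x y)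
    (U : Matrix (Fin 2) (Fin 2) ℤ) (x y : ℝ) : (A'.act U).ev x y ≤ H * (A.act U).ev x y := by
  rw [ev_act, ev_act]
  exact h _ _

lemma IsUnimodular.ev_le_of_close {A A' : BinForm} (hA : A.IsUnimodular) {C η : ℝ} (hC : 0 < C)
    (hη : 0 < η) (ha : A.a ≤ C) (hc : A.c ≤ C) (h1 : |A'.a - A.a| ≤ η / (4 * C))
    (h2 : |A'.b - A.b| ≤ η / (4 * C)) (h3 : |A'.c - A.c| ≤ η / (4 * C)) (x y : ℝ) :
    A'.ev x y ≤ (1 + η) * A.ev x y := by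
  set ε := η / (4 * C) with hε
  have h4 := hA.sq_add_sq_le x y
  have h5 : (A.a + A.c) * A.ev x y ≤ 2 * C * A.ev x y :=
    mul_le_mul_of_nonneg_right (by linarith) (hA.ev_nonneg _ _)
  have h6 : A'.ev x y - A.ev x y =
      (A'.a - A.a) * x ^ 2 + (A'.b - A.b) * (2 * x * y) + (A'.c - A.c) * y ^ 2 := by
    simp only [ev]
    ring
  have h7 : (A'.b - A.b) * (2 * x * y) ≤ ε * (x ^ 2 + y ^ 2) := by
    have : |2 * x * y| ≤ x ^ 2 + y ^ 2 := abs_le.2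
      ⟨by linarith [sq_nonneg (x + y)], by linarith [sq_nonneg (x - y)]⟩
    calc _ ≤ |(A'.b - A.b) * (2 * x * y)| := le_abs_self _
      _ = |A'.b - A.b| * |2 * x * y| := abs_mul _ _
      _ ≤ _ := mul_le_mul h2 this (abs_nonneg _) (by positivity)
  have h8 : (A'.a - A.a) * x ^ 2 ≤ ε * x ^ 2 :=
    mul_le_mul_of_nonneg_right ((le_abs_self _).trans h1) (sq_nonneg x)
  have h9 : (A'.c - A.c) * y ^ 2 ≤ ε * y ^ 2 :=
    mul_le_mul_of_nonneg_right ((le_abs_self _).trans h3) (sq_nonneg y)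
  have h10 : 2 * ε * (x ^ 2 + y ^ 2) ≤ 2 * ε * (2 * C * A.ev x y) :=
    mul_le_mul_of_nonneg_left (h4.trans h5) (by positivity)
  have h11 : 2 * ε * (2 * C * A.ev x y) = η * A.ev x y := by
    rw [hε]
    field_simp
    ring
  linarith

/-- Among many dilations of a form, many are pairwise almost equivalent through integral
matrices congruent to the identity. -/
lemma exists_almost_equivalent {δ η : ℝ} (hδ : 0 < δ) (hη : 0 < η) (N : ℕ) [NeZero N] :
    ∃ c : ℕ, ∀ Q : BinForm, Q.IsUnimodular → ∀ S : Finset ℕ, (∀ m ∈ S, 0 < m) →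
      (∀ m ∈ S, ∀ x y : ℤ, (x ≠ 0 ∨ y ≠ 0) → δ ≤ (Q.dil m).ev x y) → ∀ n, c * n ≤ S.card →
      ∃ W : ℕ → Matrix.SpecialLinearGroup (Fin 2) ℤ, ∃ S' ⊆ S, n ≤ S'.card ∧
        ∀ m ∈ S', ∀ m' ∈ S', m ≡ m' [MOD N] ∧
          (W m).1.map (Int.cast : ℤ → ZMod N) = (W m').1.map (Int.cast : ℤ → ZMod N) ∧
          ∀ x y : ℝ, (Q.dil m').ev x y ≤ (1 + η) *
            ((Q.dil m).act (W m * (W m')⁻¹ : Matrix.SpecialLinearGroup (Fin 2) ℤ)).ev x y := by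
  classical
  set C := 2 + δ⁻¹ with hC
  have hC0 : 0 < C := by positivity
  set ε := η / (4 * C) with hε
  have hε0 : 0 < ε := by positivity
  set I : Finset ℤ := Finset.Icc (-⌈C / ε⌉) ⌈C / ε⌉ with hI
  have hmemI : ∀ x : ℝ, |x| ≤ C → ⌊x / ε⌋ ∈ I := by
    intro x hx
    rw [hI, Finset.mem_Icc]
    have h1 := Int.le_ceil (C / ε)
    obtain ⟨h2, h3⟩ := abs_le.1 hx
    constructor
    · rw [Int.le_floor]
      push_cast
      have : -(C / ε) ≤ x / ε := by
        rw [← neg_div]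
        exact div_le_div_of_nonneg_right h2 hε0.le
      linarith
    · have h4 := Int.floor_le (x / ε)
      have h5 : x / ε ≤ C / ε := div_le_div_of_nonneg_right h3 hε0.le
      have h6 : (⌊x / ε⌋ : ℝ) ≤ ⌈C / ε⌉ := by linarith
      exact_mod_cast h6
  have hclose : ∀ x y : ℝ, ⌊x / ε⌋ = ⌊y / ε⌋ → |x - y| ≤ ε := by
    intro x y hxy
    have h1 := Int.abs_sub_lt_one_of_floor_eq_floor hxy
    rw [← sub_div, abs_div, abs_of_pos hε0, div_lt_one hε0] at h1
    exact h1.le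
  let t : Finset (ℤ × ℤ × ℤ × Matrix (Fin 2) (Fin 2) (ZMod N) × ZMod N) :=
    I ×ˢ I ×ˢ I ×ˢ Finset.univ
  have ht : t.Nonempty := by
    have h0 : I.Nonempty := ⟨_, hmemI 0 (by simpa using hC0.le)⟩
    exact h0.product (h0.product (h0.product Finset.univ_nonempty))
  refine ⟨t.card, fun Q hQ S hS hgood n hn => ?_⟩
  have hW : ∀ m : ℕ, ∃ W : Matrix.SpecialLinearGroup (Fin 2) ℤ, m ∈ S →
      ((Q.dil m).act W).a ≤ C ∧ ((Q.dil m).act W).c ≤ C := by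
    intro m
    by_cases hm : m ∈ S
    · have hm0 : (m : ℝ) ≠ 0 := by exact_mod_cast (hS m hm).ne'
      obtain ⟨W, hW⟩ := exists_act_bounded hδ (hQ.dil hm0) (hgood m hm)
      exact ⟨W, fun _ => hW⟩
    · exact ⟨1, fun h => absurd h hm⟩
  choose W hW using hW
  have hU : ∀ m ∈ S, ((Q.dil m).act (W m)).IsUnimodular := fun m hm =>
    (hQ.dil (by exact_mod_cast (hS m hm).ne')).act _
  let f : ℕ → ℤ × ℤ × ℤ × Matrix (Fin 2) (Fin 2) (ZMod N) × ZMod N := fun m =>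
    (⌊((Q.dil m).act (W m)).a / ε⌋, ⌊((Q.dil m).act (W m)).b / ε⌋,
      ⌊((Q.dil m).act (W m)).c / ε⌋, (W m).1.map (Int.cast : ℤ → ZMod N), (m : ZMod N))
  have hf : ∀ m ∈ S, f m ∈ t := by
    intro m hm
    have ha := (hU m hm).1
    have hc := (hU m hm).c_pos
    have hb := (hU m hm).2
    refine Finset.mk_mem_product (hmemI _ ?_) (Finset.mk_mem_product (hmemI _ ?_)
      (Finset.mk_mem_product (hmemI _ ?_) (Finset.mem_univ _)))
    · rw [abs_of_pos ha]
      exact (hW m hm).1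
    · apply abs_le_of_sq_le_sq _ hC0.le
      have := mul_le_mul (hW m hm).1 (hW m hm).2 hc.le hC0.le
      linarith
    · rw [abs_of_pos hc]
      exact (hW m hm).2
  obtain ⟨y, -, hy⟩ := Finset.exists_le_card_fiber_of_mul_le_card_of_maps_to hf ht hn
  refine ⟨W, _, Finset.filter_subset _ _, hy, ?_⟩
  intro m hm m' hm'
  rw [Finset.mem_filter] at hm hm'
  have hfm : f m = f m' := hm.2.trans hm'.2.symm
  simp only [f, Prod.mk.injEq] at hfm
  obtain ⟨e1, e2, e3, e4, e5⟩ := hfm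
  refine ⟨(ZMod.natCast_eq_natCast_iff _ _ _).1 e5, e4, ?_⟩
  have key := (hU m hm.1).ev_le_of_close hC0 hη (hW m hm.1).1 (hW m hm.1).2
    (hclose _ _ e1.symm) (hclose _ _ e2.symm) (hclose _ _ e3.symm)
  intro x y
  have := ev_act_le key ((W m')⁻¹ : Matrix.SpecialLinearGroup (Fin 2) ℤ) x y
  rwa [act_mul_inv, ← act_mul, ← Matrix.SpecialLinearGroup.coe_mul] at this

end BinForm

namespace BinForm

lemma ev_dil_mul_le {Q : BinForm} {k k' : Matrix.SpecialLinearGroup (Fin 2) ℤ} {m m' n : ℕ}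
    {H : ℝ} (hn : 0 < n)
    (h : ∀ x y : ℝ, (Q.dil m').ev x y ≤ H * ((Q.dil m).act k).ev x y)
    (h00 : k' 0 0 = k 0 0) (h01 : k' 0 1 = n ^ 2 * k 0 1) (h10 : n ^ 2 * k' 1 0 = k 1 0)
    (h11 : k' 1 1 = k 1 1) (x y : ℝ) :
    (Q.dil (m' * n)).ev x y ≤ H * ((Q.dil (m * n)).act k').ev x y := by
  have hn0 : (n : ℝ) ≠ 0 := by positivity
  have h1 := h (x / n) (n * y)
  have h10' : (n : ℝ) ^ 2 * (k' 1 0 : ℝ) = k 1 0 := by exact_mod_cast h10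
  rw [← dil_dil, ← dil_dil, ev_dil _ hn0, ev_act, ev_dil _ hn0]
  rw [ev_act] at h1
  convert h1 using 3
  · rw [h00, h01]
    push_cast
    field_simp
  · rw [← h10', h11]
    field_simp

/-- `k` is congruent to the lower unipotent matrix with parameter `s` modulo `q`. -/
def IsLowerUnip (q : ℕ) (k : Matrix.SpecialLinearGroup (Fin 2) ℤ) (s : ZMod q) : Prop :=
  ((k 0 0 : ℤ) : ZMod q) = 1 ∧ ((k 0 1 : ℤ) : ZMod q) = 0 ∧ ((k 1 0 : ℤ) : ZMod q) = s ∧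
    ((k 1 1 : ℤ) : ZMod q) = 1

lemma isLowerUnip_one (q : ℕ) : IsLowerUnip q 1 0 := by
  simp [IsLowerUnip]

lemma IsLowerUnip.mul {q : ℕ} {k k' : Matrix.SpecialLinearGroup (Fin 2) ℤ} {s s' : ZMod q}
    (h : IsLowerUnip q k s) (h' : IsLowerUnip q k' s') : IsLowerUnip q (k * k') (s + s') := by
  obtain ⟨h1, h2, h3, h4⟩ := h
  obtain ⟨h1', h2', h3', h4'⟩ := h'
  simp only [IsLowerUnip, Matrix.SpecialLinearGroup.coe_mul, Matrix.mul_apply, Fin.sum_univ_two]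
  push_cast
  simp [h1, h2, h3, h4, h1', h2', h3', h4']

/-- The form `Q` dilated by `2 ^ v` admits odd multipliers realising, up to the distortion
`H ^ k`, a set of at least `j + 1` lower unipotent classes modulo `2 ^ l`, or all even ones. -/
def Prof (l : ℕ) (H : ℝ) (k B : ℕ) (Q : BinForm) (v j : ℕ) : Prop :=
  ∃ A : Finset (ZMod (2 ^ l)), 0 ∈ A ∧ (j + 1 ≤ A.card ∨ ∀ z, 2 * z ∈ A) ∧
    ∃ M₀ : ℕ, Odd M₀ ∧ M₀ ≤ B ∧ ∀ s ∈ A, ∃ M : ℕ, Odd M ∧ M ≤ B ∧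
      (M : ZMod (2 ^ l)) = M₀ ∧ ∃ k' : Matrix.SpecialLinearGroup (Fin 2) ℤ,
        IsLowerUnip (2 ^ l) k' s ∧ ∀ x y : ℝ,
          (Q.dil (M * 2 ^ v)).ev x y ≤ H ^ k * ((Q.dil (M₀ * 2 ^ v)).act k').ev x y

variable {l k B B₁ m w u j : ℕ} {H : ℝ} {Q : BinForm}

lemma prof_zero (l : ℕ) (H : ℝ) (Q : BinForm) (v : ℕ) : Prof l H 0 1 Q v 0 := by
  refine ⟨{0}, by simp, Or.inl (by simp), 1, odd_one, le_rfl, fun s hs => ?_⟩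
  rw [Finset.mem_singleton] at hs
  subst hs
  refine ⟨1, odd_one, le_rfl, rfl, 1, isLowerUnip_one _, fun x y => ?_⟩
  simp [act_one]

lemma dil_mul_two_pow (Q : BinForm) (m M w u : ℕ) :
    (Q.dil ((m * 2 ^ w : ℕ) : ℝ)).dil (M * 2 ^ u) =
      Q.dil (((m * M : ℕ) : ℝ) * 2 ^ (w + u)) := by
  rw [dil_dil]
  congr 1
  push_cast
  ring

lemma Prof.of_dil (hQ : Q.IsUnimodular) (hH : 1 ≤ H) (hm : Odd m) (hmB : m ≤ B₁)
    (h : Prof l H k B (Q.dil ((m * 2 ^ w : ℕ) : ℝ)) u j) :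
    Prof l H (k + 1) (B₁ * B) Q (w + u) j := by
  obtain ⟨A, hA0, hA, M₀, hM₀, hM₀B, hall⟩ := h
  refine ⟨A, hA0, hA, m * M₀, hm.mul hM₀, Nat.mul_le_mul hmB hM₀B, fun s hs => ?_⟩
  obtain ⟨M, hM, hMB, hMM, k', hk', hev⟩ := hall s hs
  refine ⟨m * M, hm.mul hM, Nat.mul_le_mul hmB hMB, by push_cast; rw [hMM], k', hk',
    fun x y => ?_⟩
  have h1 := hev x y
  rw [dil_mul_two_pow, dil_mul_two_pow] at h1
  refine h1.trans (mul_le_mul_of_nonneg_right (pow_le_pow_right₀ hH (Nat.le_succ k)) ?_)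
  have := (hm.mul hM₀).pos
  exact ((hQ.dil (by positivity)).act k').ev_nonneg _ _

lemma exists_conj_isLowerUnip {l M n v : ℕ} {k₀ : Matrix.SpecialLinearGroup (Fin 2) ℤ} {N : ℕ}
    (hlN : 2 ^ l ∣ N) (hMN : M ^ 2 ∣ N) (hM : Odd M) (hn : n = M * 2 ^ v)
    (h00 : (N : ℤ) ∣ k₀ 0 0 - 1) (h01 : (N : ℤ) ∣ k₀ 0 1) (h10 : (N : ℤ) ∣ k₀ 1 0)
    (h11 : (N : ℤ) ∣ k₀ 1 1 - 1) {c : ℤ} (hc : k₀ 1 0 = 4 ^ v * c) :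
    ∃ k' : Matrix.SpecialLinearGroup (Fin 2) ℤ, k' 0 0 = k₀ 0 0 ∧ k' 0 1 = n ^ 2 * k₀ 0 1 ∧
      n ^ 2 * k' 1 0 = k₀ 1 0 ∧ k' 1 1 = k₀ 1 1 ∧
      ∃ s : ZMod (2 ^ l), (M : ZMod (2 ^ l)) ^ 2 * s = c ∧ IsLowerUnip (2 ^ l) k' s := by
  have hMc : (M : ℤ) ^ 2 ∣ c := by
    have h1 : (M : ℤ) ^ 2 ∣ 4 ^ v * c := by
      rw [← hc]
      exact (by exact_mod_cast hMN : (M : ℤ) ^ 2 ∣ N).trans h10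
    have h2 : IsCoprime (M : ℤ) ((2 : ℕ) : ℤ) :=
      Nat.isCoprime_iff_coprime.2 hM.coprime_two_right
    have h3 : IsCoprime ((M : ℤ) ^ 2) (4 ^ v) := by
      have h4 : (4 : ℤ) = ((2 : ℕ) : ℤ) ^ 2 := by norm_num
      rw [h4]
      exact h2.pow.pow_right
    exact h3.dvd_of_dvd_mul_left h1
  obtain ⟨e, he⟩ := hMc
  have hd := det_SL2 k₀
  have hn2 : (n : ℤ) ^ 2 * e = k₀ 1 0 := by
    have h4 : (4 : ℤ) ^ v = (2 ^ v) ^ 2 := by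
      rw [← pow_mul, mul_comm, pow_mul]
      norm_num
    rw [hc, he, hn, h4]
    push_cast
    ring
  let k' : Matrix.SpecialLinearGroup (Fin 2) ℤ :=
    ⟨!![k₀ 0 0, (n : ℤ) ^ 2 * k₀ 0 1; e, k₀ 1 1], by
      rw [Matrix.det_fin_two_of]
      linear_combination hd - k₀ 0 1 * hn2⟩
  have hl : ((2 ^ l : ℕ) : ℤ) ∣ N := by exact_mod_cast hlN
  refine ⟨k', rfl, rfl, hn2, rfl, (e : ZMod (2 ^ l)), ?_, ?_, ?_, rfl, ?_⟩
  · rw [he]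
    push_cast
    ring
  · change ((k₀ 0 0 : ℤ) : ZMod (2 ^ l)) = 1
    have := (ZMod.intCast_zmod_eq_zero_iff_dvd _ _).2 (hl.trans h00)
    push_cast at this
    exact sub_eq_zero.1 this
  · change (((n : ℤ) ^ 2 * k₀ 0 1 : ℤ) : ZMod (2 ^ l)) = 0
    exact (ZMod.intCast_zmod_eq_zero_iff_dvd _ _).2 ((hl.trans h01).mul_left _)
  · change ((k₀ 1 1 : ℤ) : ZMod (2 ^ l)) = 1
    have := (ZMod.intCast_zmod_eq_zero_iff_dvd _ _).2 (hl.trans h11)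
    push_cast at this
    exact sub_eq_zero.1 this

lemma isUnit_intCast_of_odd {l : ℕ} {d : ℤ} (hd : Odd d) : IsUnit (d : ZMod (2 ^ l)) := by
  have h1 : IsCoprime d ((2 ^ l : ℕ) : ℤ) := by
    push_cast
    obtain ⟨e, rfl⟩ := hd
    exact IsCoprime.pow_right ⟨1, -e, by ring⟩
  obtain ⟨a, b, hab⟩ := h1
  have h2 := congrArg (Int.cast : ℤ → ZMod (2 ^ l)) hab
  push_cast at h2
  have h3 : (2 : ZMod (2 ^ l)) ^ l = 0 := by exact_mod_cast ZMod.natCast_self (2 ^ l)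
  rw [h3, mul_zero, add_zero] at h2
  exact IsUnit.of_mul_eq_one_right _ h2

lemma exists_mul_eq_two {l : ℕ} {c : ℤ} (hc : ¬ (4 : ℤ) ∣ c) :
    ∃ y : ZMod (2 ^ l), (c : ZMod (2 ^ l)) * y = 2 := by
  rcases Int.even_or_odd c with h | h
  · obtain ⟨d, rfl⟩ := h.two_dvd
    have hd : Odd d := by
      rw [← Int.not_even_iff_odd]
      rintro ⟨e, rfl⟩
      exact hc ⟨e, by ring⟩
    obtain ⟨y, hy⟩ := (isUnit_intCast_of_odd hd).exists_right_inv
    exact ⟨y, by push_cast; rw [mul_assoc, hy, mul_one]⟩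
  · obtain ⟨y, hy⟩ := (isUnit_intCast_of_odd h).exists_right_inv
    exact ⟨y * 2, by rw [← mul_assoc, hy, one_mul]⟩

lemma isUnit_natCast_of_odd {l M : ℕ} (hM : Odd M) : IsUnit (M : ZMod (2 ^ l)) := by
  rw [ZMod.isUnit_iff_coprime]
  exact hM.coprime_two_right.pow_right l

lemma Prof.branch (hQ : Q.IsUnimodular) (hH : 1 ≤ H) {m' N : ℕ}
    {k₀ : Matrix.SpecialLinearGroup (Fin 2) ℤ} (hm : Odd m) (hmB : m ≤ B₁) (hm' : Odd m')
    (hmB' : m' ≤ B₁) (hmm : m ≡ m' [MOD N]) (hlN : 2 ^ l ∣ N)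
    (hBN : ∀ M : ℕ, 1 ≤ M → M ≤ B → M ^ 2 ∣ N)
    (h00 : (N : ℤ) ∣ k₀ 0 0 - 1) (h01 : (N : ℤ) ∣ k₀ 0 1) (h10 : (N : ℤ) ∣ k₀ 1 0)
    (h11 : (N : ℤ) ∣ k₀ 1 1 - 1)
    (hev₀ : ∀ x y : ℝ, (Q.dil m').ev x y ≤ H * ((Q.dil m).act k₀).ev x y)
    (hdvd : (4 : ℤ) ^ (w + u) ∣ k₀ 1 0) (hndvd : ¬ (4 : ℤ) ^ (w + u + 1) ∣ k₀ 1 0)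
    (h : Prof l H k B (Q.dil ((m * 2 ^ w : ℕ) : ℝ)) u j) :
    Prof l H (k + 1) (B₁ * B) Q (w + u) (j + 1) := by
  classical
  obtain ⟨A, hA0, hA, M₀, hM₀, hM₀B, hall⟩ := h
  obtain ⟨c, hc⟩ := hdvd
  have hc4 : ¬ (4 : ℤ) ∣ c := by
    rintro ⟨d, rfl⟩
    exact hndvd ⟨d, by rw [hc]; ring⟩
  obtain ⟨i, hi⟩ := (isUnit_natCast_of_odd (l := l) (hM₀.pow (n := 2))).exists_left_inv
  push_cast at hi
  set s₀ : ZMod (2 ^ l) := i * c with hs₀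
  have hmm' : (m' : ZMod (2 ^ l)) = m :=
    ((ZMod.natCast_eq_natCast_iff _ _ _).2 (hmm.of_dvd hlN)).symm
  refine ⟨A ∪ A.image (· + s₀), Finset.mem_union_left _ hA0, ?_, m * M₀, hm.mul hM₀,
    Nat.mul_le_mul hmB hM₀B, ?_⟩
  · rcases hA with hA | hA
    · by_cases hsub : A.image (· + s₀) ⊆ A
      · right
        intro z
        apply Finset.mem_union_left
        have hmul : ∀ n : ℕ, (n : ZMod (2 ^ l)) * s₀ ∈ A := by
          intro n
          induction n with
          | zero => simpa using hA0
          | succ n ih =>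
            have := hsub (Finset.mem_image_of_mem _ ih)
            push_cast
            rwa [add_mul, one_mul]
        obtain ⟨y, hy⟩ := exists_mul_eq_two (l := l) hc4
        have h1 := hmul (y * z * M₀ ^ 2 : ZMod (2 ^ l)).val
        rw [ZMod.natCast_zmod_val, hs₀] at h1
        convert h1 using 1
        linear_combination (-z) * hy - (y * z * c) * hi
      · left
        have : A.card < (A ∪ A.image (· + s₀)).card := by
          apply Finset.card_lt_card
          refine ⟨Finset.subset_union_left, fun h => hsub (Finset.subset_union_right.trans h)⟩
        omega
    · exact Or.inr fun z => Finset.mem_union_left _ (hA z)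
  · intro s hs
    rw [Finset.mem_union] at hs
    rcases hs with hs | hs
    · obtain ⟨M, hM, hMB, hMM, k', hk', hev⟩ := hall s hs
      refine ⟨m * M, hm.mul hM, Nat.mul_le_mul hmB hMB, by push_cast; rw [hMM], k', hk',
        fun x y => ?_⟩
      have h1 := hev x y
      rw [dil_mul_two_pow, dil_mul_two_pow] at h1
      refine h1.trans (mul_le_mul_of_nonneg_right (pow_le_pow_right₀ hH (Nat.le_succ k)) ?_)
      have := (hm.mul hM₀).pos
      exact ((hQ.dil (by positivity)).act k').ev_nonneg _ _
    · obtain ⟨s', hs', rfl⟩ := Finset.mem_image.1 hs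
      obtain ⟨M, hM, hMB, hMM, k', hk', hev⟩ := hall s' hs'
      obtain ⟨k₁, e00, e01, e10, e11, s₁, hs₁, hk₁⟩ := exists_conj_isLowerUnip hlN
        (hBN M hM.pos hMB) hM rfl h00 h01 h10 h11 hc
      have hss : s₁ = s₀ := by
        rw [hMM] at hs₁
        rw [hs₀, ← hs₁, ← mul_assoc, hi, one_mul]
      refine ⟨m' * M, hm'.mul hM, Nat.mul_le_mul hmB' hMB, ?_, k' * k₁, hk'.mul (hss ▸ hk₁),
        fun x y => ?_⟩
      · push_cast
        rw [hMM, hmm']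
      · have hpos := hM.pos
        have h1 := ev_dil_mul_le (by positivity) hev₀ e00 e01 e10 e11 x y
        have h2 := ev_act_le hev k₁ x y
        rw [dil_mul_two_pow, dil_mul_two_pow, ← act_mul,
          ← Matrix.SpecialLinearGroup.coe_mul] at h2
        have e1 : ∀ a : ℕ, (a : ℝ) * ((M * 2 ^ (w + u) : ℕ) : ℝ) =
            ((a * M : ℕ) : ℝ) * 2 ^ (w + u) := by
          intro a
          push_cast
          ring
        rw [e1, e1] at h1
        calc _ ≤ _ := h1
          _ ≤ _ := mul_le_mul_of_nonneg_left h2 (by linarith)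
          _ = _ := by rw [pow_succ]; ring

end BinForm

lemma sum_range_mul_div_mod {V : ℕ} (hV : 0 < V) (u : ℕ) (f : ℕ → ℕ → ℕ) :
    ∑ v ∈ Finset.range (V * u), f (v / V) (v % V) =
      ∑ i ∈ Finset.range u, ∑ j ∈ Finset.range V, f i j := by
  induction u with
  | zero => simp
  | succ u ih =>
    rw [mul_add, mul_one, Finset.sum_range_add, ih, Finset.sum_range_succ]
    congr 1
    apply Finset.sum_congr rfl
    intro j hj
    rw [Finset.mem_range] at hj
    rw [Nat.mul_add_div hV, Nat.mul_add_mod, Nat.div_eq_of_lt hj, Nat.mod_eq_of_lt hj, add_zero]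

lemma map_mul_inv_eq_one {N : ℕ} {U W : Matrix.SpecialLinearGroup (Fin 2) ℤ}
    (h : U.1.map (Int.cast : ℤ → ZMod N) = W.1.map (Int.cast : ℤ → ZMod N)) :
    ((U * W⁻¹ : Matrix.SpecialLinearGroup (Fin 2) ℤ).1.map (Int.cast : ℤ → ZMod N)) = 1 := by
  have hmul : ∀ X Y : Matrix.SpecialLinearGroup (Fin 2) ℤ,
      (X * Y : Matrix.SpecialLinearGroup (Fin 2) ℤ).1.map (Int.cast : ℤ → ZMod N) =
        X.1.map (Int.cast : ℤ → ZMod N) * Y.1.map (Int.cast : ℤ → ZMod N) := fun X Y =>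
    Matrix.map_mul (f := Int.castRingHom (ZMod N))
  rw [hmul, h, ← hmul, mul_inv_cancel]
  ext i j
  simp [Matrix.one_apply]

lemma dvd_of_map_eq_one {N : ℕ} {k : Matrix (Fin 2) (Fin 2) ℤ}
    (h : k.map (Int.cast : ℤ → ZMod N) = 1) :
    (N : ℤ) ∣ k 0 0 - 1 ∧ (N : ℤ) ∣ k 0 1 ∧ (N : ℤ) ∣ k 1 0 ∧ (N : ℤ) ∣ k 1 1 - 1 := by
  have e := fun i j => congrFun (congrFun h i) j
  simp only [Matrix.map_apply] at e
  simp only [← ZMod.intCast_zmod_eq_zero_iff_dvd]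
  push_cast
  simp [e]

namespace BinForm

lemma mul_inv_one_zero (X Y : Matrix.SpecialLinearGroup (Fin 2) ℤ) :
    (X * Y⁻¹ : Matrix.SpecialLinearGroup (Fin 2) ℤ) 1 0 = X 1 0 * Y 1 1 - X 1 1 * Y 1 0 := by
  rw [Matrix.SpecialLinearGroup.coe_mul, Matrix.mul_apply, Fin.sum_univ_two,
    Matrix.SpecialLinearGroup.coe_inv, Matrix.adjugate_fin_two]
  simp only [Matrix.of_apply, Matrix.cons_val', Matrix.cons_val_one, Matrix.cons_val_fin_one,
    Matrix.cons_val_zero]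
  ring

/-- The lower left entry of `W m * (W m')⁻¹`. -/
def transEntry (W : ℕ → Matrix.SpecialLinearGroup (Fin 2) ℤ) (m m' : ℕ) : ℤ :=
  (W m * (W m')⁻¹ : Matrix.SpecialLinearGroup (Fin 2) ℤ) 1 0

lemma transEntry_eq (W : ℕ → Matrix.SpecialLinearGroup (Fin 2) ℤ) (m m' z : ℕ) :
    transEntry W m m' =
      transEntry W m z * (W m' * (W z)⁻¹ : Matrix.SpecialLinearGroup (Fin 2) ℤ) 1 1 -
      (W m * (W z)⁻¹ : Matrix.SpecialLinearGroup (Fin 2) ℤ) 1 1 * transEntry W m' z := by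
  have h : W m * (W m')⁻¹ = (W m * (W z)⁻¹) * (W m' * (W z)⁻¹)⁻¹ := by group
  rw [transEntry, transEntry, transEntry, h, mul_inv_one_zero]

lemma transEntry_symm (W : ℕ → Matrix.SpecialLinearGroup (Fin 2) ℤ) (m m' : ℕ) :
    transEntry W m' m = -transEntry W m m' := by
  rw [transEntry, transEntry, mul_inv_one_zero, mul_inv_one_zero]
  ring

lemma exists_profs {δ : ℝ} (hδ : 0 < δ) : ∃ R : ℕ, 0 < R ∧ ∀ l ≥ 2, ∀ H : ℝ, 1 < H → H ≤ 2 →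
    ∀ k : ℕ, ∃ V B G : ℕ, 0 < V ∧ ∀ Q : BinForm, Q.IsUnimodular → Good δ G Q →
      ∃ f : ℕ → ℕ, k * V ≤ R * ∑ v ∈ Finset.range V, f v ∧
        ∀ v < V, Prof l H k B Q v (f v) := by
  obtain ⟨L, t₁, K, hL, hsep⟩ := exists_separated hδ
  refine ⟨4 * L, by omega, fun l hl H hH1 hH2 k => ?_⟩
  induction k with
  | zero =>
    refine ⟨1, 1, 0, one_pos, fun Q _ _ => ⟨fun _ => 0, by simp, fun v _ => prof_zero l H Q v⟩⟩
  | succ k ih =>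
    obtain ⟨V, B, G, hV, ih⟩ := ih
    set N := B.factorial ^ 2 * 2 ^ l with hN
    have hN0 : N ≠ 0 := by positivity
    have : NeZero N := ⟨hN0⟩
    obtain ⟨c, hcol⟩ := exists_almost_equivalent hδ (sub_pos.2 hH1) N
    set h := V * (t₁ + c + 1) with hh
    have hle : t₁ + c + 1 ≤ h := Nat.le_mul_of_pos_left _ hV
    obtain ⟨Bs, hBs⟩ := hsep (2 * h) (by omega)
    set B₁ := 2 ^ (K * (2 * h)) with hB₁
    set V' := L * (2 * h) with hV'
    have hV'u : V' = V * (2 * L * (t₁ + c + 1)) := by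
      rw [hV', hh]
      ring
    set u := 2 * L * (t₁ + c + 1) with hu
    refine ⟨V', B₁ * B, Bs + B₁ * 2 ^ V' * (G + 1), by positivity, fun Q hQ hG => ?_⟩
    obtain ⟨S, hSB, hScard, hSsep⟩ := hBs Q hQ (hG.mono (Nat.le_add_right _ _))
    have hpow1 : 1 ≤ 2 ^ V' := Nat.one_le_two_pow
    have hgood : ∀ m ∈ S, ∀ w ≤ V', Good δ G (Q.dil ((m * 2 ^ w : ℕ) : ℝ)) := by
      intro m hm w hw
      refine hG.dil (Nat.mul_pos (hSB m hm).1.pos (by positivity)) ?_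
      have h1 : m * 2 ^ w * G ≤ B₁ * 2 ^ V' * (G + 1) := by
        gcongr
        · exact (hSB m hm).2
        · norm_num
        · omega
      omega
    obtain ⟨W, S', hS'S, hS'card, hS'⟩ := hcol Q hQ S (fun m hm => (hSB m hm).1.pos)
      (fun m hm => hG m (hSB m hm).1.pos (by
        have h1 := (hSB m hm).2
        have h2 : B₁ * 1 * 1 ≤ B₁ * 2 ^ V' * (G + 1) := by
          gcongr
          omega
        omega)) (2 ^ h) (by
        have h1 : c ≤ 2 ^ h := by
          have : h < 2 ^ h := Nat.lt_two_pow_self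
          omega
        calc c * 2 ^ h ≤ 2 ^ h * 2 ^ h := Nat.mul_le_mul_right _ h1
          _ = 2 ^ (2 * h) := by rw [← pow_add, two_mul]
          _ ≤ _ := hScard)
    have hH : 1 + (H - 1) = H := by ring
    rw [hH] at hS'
    have hcong := fun m hm m' hm' => dvd_of_map_eq_one (map_mul_inv_eq_one (hS' m hm m' hm').2.1)
    have hd4 : (4 : ℤ) ∣ N := by
      have h1 : 4 ∣ N := by
        rw [hN]
        refine Dvd.dvd.mul_left ?_ _
        exact (by norm_num : 4 = 2 ^ 2) ▸ pow_dvd_pow 2 hl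
      exact_mod_cast h1
    obtain ⟨m, hm, hleaf⟩ := exists_card_le_four_pow
      (E := fun v m m' => (4 : ℤ) ^ v ∣ transEntry W m m')
      (fun v x y hxy => by rw [transEntry_symm]; exact hxy.neg_right)
      (fun v x y z hxy hyz => by
        rw [transEntry_eq W x z y]
        rw [transEntry_symm] at hyz
        exact dvd_sub (hxy.mul_right _) ((dvd_neg.1 hyz).mul_left _))
      V' 0 S' (Finset.card_pos.1 (lt_of_lt_of_le (by positivity) hS'card))
      (fun x _ y _ => by simp)
      (fun i z hz => by
        refine ⟨fun x => ((transEntry W x z / 4 ^ i : ℤ) : ZMod 4), ?_⟩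
        intro x hx y hy hxz hyz hg
        obtain ⟨e, he⟩ := hxz
        obtain ⟨e', he'⟩ := hyz
        have h4 : (4 : ℤ) ^ i ≠ 0 := by positivity
        simp only [he, he', Int.mul_ediv_cancel_left _ h4] at hg
        rw [ZMod.intCast_eq_intCast_iff_dvd_sub] at hg
        obtain ⟨p, hp⟩ := hd4.trans (hcong x hx z hz).2.2.2
        obtain ⟨p', hp'⟩ := hd4.trans (hcong y hy z hz).2.2.2
        obtain ⟨r, hr⟩ := hg
        rw [transEntry_eq W x y z, he, he', sub_eq_iff_eq_add.1 hp, sub_eq_iff_eq_add.1 hp']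
        refine ⟨e * p' - p * e' - r, ?_⟩
        push_cast at hr
        rw [pow_succ]
        linear_combination (-4 ^ i : ℤ) * hr)
      (fun x hx y hy hxy => by
        by_contra hne
        rw [zero_add] at hxy
        refine hSsep x (hS'S hx) y (hS'S hy) hne _ ⟨hxy, fun a b => ?_⟩
        refine ((hS' x hx y hy).2.2 a b).trans (mul_le_mul_of_nonneg_right hH2 ?_)
        have := (hSB x (hS'S hx)).1.pos
        exact ((hQ.dil (by positivity)).act _).ev_nonneg _ _)
    obtain ⟨b, hb, hbr⟩ : ∃ b : ℕ → ℕ, S'.card ≤ 4 ^ ∑ i ∈ Finset.range V', b i ∧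
        ∀ i, b i = 0 ∨ b i = 1 ∧ ∃ y ∈ S', (4 : ℤ) ^ i ∣ transEntry W m y ∧
          ¬ (4 : ℤ) ^ (i + 1) ∣ transEntry W m y := by
      refine ⟨_, hleaf, fun i => ?_⟩
      split_ifs with hi
      · exact Or.inr ⟨rfl, by simpa only [zero_add] using hi⟩
      · exact Or.inl rfl
    have hmS := hS'S hm
    have hwin : ∀ i : ℕ, ∃ f : ℕ → ℕ, i < u → k * V ≤ 4 * L * ∑ v ∈ Finset.range V, f v ∧
        ∀ v < V, Prof l H k B (Q.dil ((m * 2 ^ (V * i) : ℕ) : ℝ)) v (f v) := by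
      intro i
      by_cases hi : i < u
      · have hm0 := (hSB m hmS).1.pos
        obtain ⟨f, hf⟩ := ih (Q.dil ((m * 2 ^ (V * i) : ℕ) : ℝ)) (hQ.dil (by positivity))
          (hgood m hmS _ (by rw [hV'u]; exact Nat.mul_le_mul_left _ hi.le))
        exact ⟨f, fun _ => hf⟩
      · exact ⟨0, fun h => absurd h hi⟩
    choose f hf using hwin
    refine ⟨fun v => f (v / V) (v % V) + b v, ?_, fun v hv => ?_⟩
    · have hbig : h ≤ 2 * ∑ i ∈ Finset.range V', b i := by
        have h1 := hS'card.trans hb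
        rw [show (4 : ℕ) = 2 ^ 2 by norm_num, ← pow_mul] at h1
        exact (Nat.pow_le_pow_iff_right (by norm_num)).1 h1
      have hwsum : k * V' ≤ 4 * L * ∑ v ∈ Finset.range V', f (v / V) (v % V) := by
        rw [hV'u, sum_range_mul_div_mod hV, Finset.mul_sum]
        calc k * (V * u) = ∑ i ∈ Finset.range u, k * V := by
              rw [Finset.sum_const, Finset.card_range, smul_eq_mul]
              ring
          _ ≤ _ := Finset.sum_le_sum fun i hi => (hf i (Finset.mem_range.1 hi)).1
      have hbsum : V' ≤ 4 * L * ∑ v ∈ Finset.range V', b v := by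
        calc V' = 2 * L * h := by rw [hV']; ring
          _ ≤ 2 * L * (2 * ∑ i ∈ Finset.range V', b i) := Nat.mul_le_mul_left _ hbig
          _ = _ := by ring
      rw [Finset.sum_add_distrib, mul_add, add_mul, one_mul]
      exact add_le_add hwsum hbsum
    · have hdiv : v / V < u := by
        rw [Nat.div_lt_iff_lt_mul hV, mul_comm, ← hV'u]
        exact hv
      have hp := (hf _ hdiv).2 (v % V) (Nat.mod_lt _ hV)
      have hvv : V * (v / V) + v % V = v := Nat.div_add_mod v V
      rcases hbr v with h0 | ⟨h1, y, hy, hy1, hy2⟩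
      · have := hp.of_dil hQ hH1.le (hSB m hmS).1 (hSB m hmS).2
        rw [hvv] at this
        simpa only [h0, add_zero] using this
      · obtain ⟨c00, c01, c10, c11⟩ := hcong m hm y hy
        have := hp.branch hQ hH1.le (hSB m hmS).1 (hSB m hmS).2 (hSB y (hS'S hy)).1
          (hSB y (hS'S hy)).2 (hS' m hm y hy).1 (Dvd.intro_left _ rfl)
          (fun M hM hMB => Dvd.dvd.mul_right (pow_dvd_pow_of_dvd (Nat.dvd_factorial hM hMB) 2) _)
          c00 c01 c10 c11 (hS' m hm y hy).2.2 (by rw [hvv]; exact hy1) (by rw [hvv]; exact hy2)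
        rw [hvv] at this
        simpa only [h1] using this

end BinForm

namespace BinForm

lemma exists_odd_even_small {A : BinForm} {C : ℝ} (hA : A.IsUnimodular)
    {W : Matrix.SpecialLinearGroup (Fin 2) ℤ} (ha : (A.act W).a ≤ C) (hc : (A.act W).c ≤ C) :
    ∃ u e : ℤ, Odd u ∧ A.ev u ((2 * e : ℤ) : ℝ) ≤ 4 * C := by
  have hd := det_SL2 W
  have hU := hA.act W
  have hcases : ∀ z : ℤ, ∃ r : ℤ, (r : ℝ) ^ 2 ≤ 1 ∧ ∃ q, z = r + 2 * q := by
    intro z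
    refine ⟨z % 2, ?_, z / 2, (Int.emod_add_mul_ediv z 2).symm⟩
    rcases Int.emod_two_eq_zero_or_one z with h | h <;> rw [h] <;> norm_num
  obtain ⟨a, ha1, q, hq⟩ := hcases (W 1 1)
  obtain ⟨b, hb1, q', hq'⟩ := hcases (W 1 0)
  refine ⟨W 0 0 * a + W 0 1 * b, a * b + b * q + a * q', ?_, ?_⟩
  · refine ⟨W 0 1 * (W 1 0) - W 0 0 * q - W 0 1 * q', ?_⟩
    linear_combination hd - W 0 0 * hq - W 0 1 * hq'
  · have h1 : A.ev ((W 0 0 * a + W 0 1 * b : ℤ) : ℝ)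
        ((2 * (a * b + b * q + a * q') : ℤ) : ℝ) = (A.act W).ev (a + 0) (0 + b) := by
      rw [ev_act, hq, hq']
      push_cast
      congr 1 <;> ring
    rw [h1]
    refine (hU.ev_add_le _ _ _ _).trans ?_
    have h2 : (A.act W).ev a 0 ≤ C := by
      simp only [ev]
      nlinarith [hU.1]
    have h3 : (A.act W).ev 0 b ≤ C := by
      simp only [ev]
      nlinarith [hU.c_pos]
    linarith

/-- The dilations by bounded multipliers of a unimodular form cannot all be uniformly
nondegenerate on integral vectors. -/
theorem exists_not_good {δ : ℝ} (hδ : 0 < δ) :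
    ∃ B : ℕ, ∀ Q : BinForm, Q.IsUnimodular → ¬ Good δ B Q := by
  obtain ⟨R, hR, hprof⟩ := exists_profs hδ
  set C := 2 + δ⁻¹ with hC
  have hC0 : 0 < C := by positivity
  obtain ⟨p', hp'⟩ := exists_nat_gt (12 * C / δ)
  set p := p' + 1 with hp
  set l := 2 * p with hl
  set k := R * 2 ^ l with hk
  have hk0 : 0 < k := by positivity
  set H : ℝ := 1 + 1 / k with hH
  have hk1 : (1 : ℝ) ≤ k := by exact_mod_cast hk0
  have hkinv : 0 < 1 / (k : ℝ) := by positivity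
  have hH2 : H ≤ 2 := by
    have : 1 / (k : ℝ) ≤ 1 := by
      rw [div_le_one (by positivity)]
      exact hk1
    linarith
  have hHk : H ^ k ≤ 3 := by
    have h1 : H ≤ Real.exp (1 / k) := by
      have := Real.add_one_le_exp (1 / (k : ℝ))
      linarith
    calc H ^ k ≤ Real.exp (1 / k) ^ k := pow_le_pow_left₀ (by linarith) h1 k
      _ = Real.exp 1 := by
        rw [← Real.exp_nat_mul]
        congr 1
        field_simp
      _ ≤ 3 := by linarith [Real.exp_one_lt_d9]
  obtain ⟨V, B, G, hV, hVP⟩ := hprof l (by omega) H (by linarith) hH2 k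
  refine ⟨G + B * 2 ^ V * 2 ^ p, fun Q hQ hG => ?_⟩
  obtain ⟨f, hf, hfP⟩ := hVP Q hQ (hG.mono (Nat.le_add_right _ _))
  obtain ⟨v, hv, hfv⟩ : ∃ v < V, 2 ^ l ≤ f v := by
    by_contra! hcon
    have h1 : ∑ v ∈ Finset.range V, f v < V * 2 ^ l := by
      calc _ < ∑ v ∈ Finset.range V, 2 ^ l := Finset.sum_lt_sum_of_nonempty
            (by simpa using hV.ne') fun v hv => hcon v (Finset.mem_range.1 hv)
        _ = _ := by simp
    have h2 := Nat.mul_lt_mul_of_pos_left h1 hR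
    have h3 : k * V = R * (V * 2 ^ l) := by rw [hk]; ring
    omega
  obtain ⟨A, -, hA, M₀, hM₀, hM₀B, hall⟩ := hfP v hv
  have hA2 : ∀ z, 2 * z ∈ A := by
    refine hA.resolve_left fun h => ?_
    have := Finset.card_le_univ A
    rw [ZMod.card] at this
    omega
  have hgood : ∀ M, Odd M → M ≤ B → ∀ i ≤ p, ∀ x y : ℤ, (x ≠ 0 ∨ y ≠ 0) →
      δ ≤ (Q.dil ((M * 2 ^ v * 2 ^ i : ℕ) : ℝ)).ev x y := by
    intro M hM hMB i hi
    refine hG _ (Nat.mul_pos (Nat.mul_pos hM.pos (by positivity)) (by positivity)) ?_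
    have : M * 2 ^ v * 2 ^ i ≤ B * 2 ^ V * 2 ^ p := by
      gcongr <;> norm_num
    omega
  have hM₀0 := hM₀.pos
  have hQ₀ : (Q.dil (M₀ * 2 ^ v)).IsUnimodular := hQ.dil (by positivity)
  obtain ⟨W, hWa, hWc⟩ := exists_act_bounded hδ hQ₀ (fun x y hxy => by
    have := hgood M₀ hM₀ hM₀B 0 (Nat.zero_le _) x y hxy
    simpa using this)
  obtain ⟨u, e, hu, hue⟩ := exists_odd_even_small hQ₀ hWa hWc
  obtain ⟨i, hi⟩ := (isUnit_intCast_of_odd (l := l) hu).exists_left_inv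
  obtain ⟨M, hM, hMB, -, κ, ⟨h00, h01, h10, h11⟩, hev⟩ := hall (2 * (i * e)) (hA2 _)
  have hdvd : ((2 ^ l : ℕ) : ℤ) ∣ -κ 1 0 * u + κ 0 0 * (2 * e) := by
    rw [← ZMod.intCast_zmod_eq_zero_iff_dvd]
    push_cast
    rw [h10, h00]
    linear_combination (-2 * (e : ZMod (2 ^ l))) * hi
  obtain ⟨y, hy⟩ := hdvd
  push_cast at hy
  set x : ℤ := κ 1 1 * u - κ 0 1 * (2 * e) with hx
  have hdet := det_SL2 κ
  have e1 : κ 0 0 * x + κ 0 1 * (2 ^ l * y) = u := by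
    rw [← hy, hx]
    linear_combination u * hdet
  have e2 : κ 1 0 * x + κ 1 1 * (2 ^ l * y) = 2 * e := by
    rw [← hy, hx]
    linear_combination (2 * e) * hdet
  have hne : x ≠ 0 ∨ y ≠ 0 := by
    by_contra! hcon
    rw [hcon.1, hcon.2, mul_zero, mul_zero, mul_zero, add_zero] at e1
    rw [← e1] at hu
    exact absurd hu (by decide)
  have hlow := hgood M hM hMB p le_rfl x y hne
  have hup := hev x ((2 ^ l * y : ℤ) : ℝ)
  have e1' : (κ 0 0 : ℝ) * x + κ 0 1 * ((2 ^ l * y : ℤ) : ℝ) = u := by exact_mod_cast e1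
  have e2' : (κ 1 0 : ℝ) * x + κ 1 1 * ((2 ^ l * y : ℤ) : ℝ) = ((2 * e : ℤ) : ℝ) := by
    exact_mod_cast e2
  rw [ev_act, e1', e2'] at hup
  have hp2 : (2 : ℝ) ^ p ≠ 0 := by positivity
  have e3 : (Q.dil ((M * 2 ^ v * 2 ^ p : ℕ) : ℝ)).ev x y =
      ((2 : ℝ) ^ l)⁻¹ * (Q.dil (M * 2 ^ v)).ev x ((2 ^ l * y : ℤ) : ℝ) := by
    have h1 : ((2 : ℝ) ^ l)⁻¹ = (((2 : ℝ) ^ p)⁻¹) ^ 2 := by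
      rw [hl, mul_comm, pow_mul, inv_pow]
    have h2 : ((M * 2 ^ v * 2 ^ p : ℕ) : ℝ) = (M * 2 ^ v) * 2 ^ p := by push_cast; ring
    rw [h2, ← dil_dil, ev_dil _ hp2, h1, ← ev_mul]
    congr 1
    · rw [div_eq_inv_mul]
    · rw [hl, mul_comm 2 p, pow_mul]
      push_cast
      field_simp
  have h4 : H ^ k * (Q.dil (M₀ * 2 ^ v)).ev u ((2 * e : ℤ) : ℝ) ≤ 3 * (4 * C) :=
    mul_le_mul hHk hue (hQ₀.ev_nonneg _ _) (by norm_num)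
  have h5 : 12 * C < δ * 2 ^ l := by
    have h6 : (p' : ℝ) < 2 ^ l := by
      have : p' < 2 ^ l := by
        have : l < 2 ^ l := Nat.lt_two_pow_self
        omega
      exact_mod_cast this
    rw [div_lt_iff₀ hδ] at hp'
    nlinarith
  rw [e3] at hlow
  have h7 : δ * 2 ^ l ≤ (Q.dil (M * 2 ^ v)).ev x ((2 ^ l * y : ℤ) : ℝ) := by
    have h8 := mul_le_mul_of_nonneg_right hlow (by positivity : (0 : ℝ) ≤ 2 ^ l)
    rwa [mul_comm (((2 : ℝ) ^ l)⁻¹), mul_assoc, inv_mul_cancel₀ (by positivity), mul_one] at h8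
  linarith

end BinForm

theorem cfCoeff_gaussMap (y : ℝ) (j : ℕ) :
    cfCoeff (gaussMap y) (j + 1) = cfCoeff y (j + 2) := by
  simp [cfCoeff]

theorem gaussMap_irrational {y : ℝ} (hy : Irrational y) : Irrational (gaussMap y) := by
  unfold gaussMap Int.fract
  exact (irrational_inv_iff.mpr hy).sub_intCast _

theorem gaussMap_mem {y : ℝ} (hy : Irrational y) : gaussMap y ∈ Set.Ioo (0 : ℝ) 1 := by
  refine ⟨lt_of_le_of_ne (Int.fract_nonneg _) ?_, Int.fract_lt_one _⟩
  exact fun h => (gaussMap_irrational hy).ne_zero h.symm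

/-- One step of the continued fraction algorithm preserves the approximation quality
`|q y - p| (q + θ p) / (1 + θ y)`. -/
theorem approx_descent {y θ δ a q p : ℝ} (hy : 0 < y) (ha : 0 < a + θ)
    (h : δ * (1 + (a + θ)⁻¹ * (y⁻¹ - a)) ≤
      |p * (y⁻¹ - a) - (q - a * p)| * (p + (a + θ)⁻¹ * (q - a * p))) :
    δ * (1 + θ * y) ≤ |q * y - p| * (q + θ * p) := by
  have e1 : |p * (y⁻¹ - a) - (q - a * p)| = |q * y - p| / y := by
    rw [abs_sub_comm (q * y), ← abs_of_pos hy, ← abs_div, abs_of_pos hy]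
    congr 1
    field_simp
    ring
  have e2 : p + (a + θ)⁻¹ * (q - a * p) = (q + θ * p) / (a + θ) := by
    field_simp
    ring
  have e3 : 1 + (a + θ)⁻¹ * (y⁻¹ - a) = (1 + θ * y) / (y * (a + θ)) := by
    field_simp
    ring
  rw [e1, e2, e3, div_mul_div_comm, ← mul_div_assoc] at h
  exact (div_le_div_iff_of_pos_right (by positivity)).mp h

theorem mul_floor_inv_le {y : ℝ} (hy : 0 < y) : (⌊y⁻¹⌋ : ℝ) * y ≤ 1 := by
  have := Int.floor_le y⁻¹
  calc (⌊y⁻¹⌋ : ℝ) * y ≤ y⁻¹ * y := by gcongr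
    _ = 1 := inv_mul_cancel₀ hy.ne'

theorem one_le_floor_inv {y : ℝ} (hy : y ∈ Set.Ioo (0 : ℝ) 1) : 1 ≤ ⌊y⁻¹⌋ := by
  rw [Int.le_floor]
  push_cast
  exact (one_lt_inv_iff₀.mpr hy).le

/-- A numerator above the first convergent gives a bad approximation. -/
theorem le_abs_of_lt_floor_mul {y : ℝ} (hy : 0 < y) {q p : ℤ} (hp : 0 ≤ p)
    (h : q < ⌊y⁻¹⌋ * p) : y ≤ |(q : ℝ) * y - p| := by
  have h1 : (q : ℝ) + 1 ≤ ⌊y⁻¹⌋ * p := by exact_mod_cast h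
  have h2 := mul_floor_inv_le hy
  have h3 : (0 : ℝ) ≤ p := by exact_mod_cast hp
  rw [abs_sub_comm]
  refine le_trans ?_ (le_abs_self _)
  nlinarith

theorem approx_of_cfCoeff_le {K : ℕ} (n : ℕ) : ∀ (y : ℝ), Irrational y →
    y ∈ Set.Ioo (0 : ℝ) 1 → (∀ j, cfCoeff y (j + 1) ≤ K) → ∀ θ ∈ Set.Icc (0 : ℝ) 1,
    ∀ q p : ℤ, 1 ≤ q → 0 ≤ p → q + p ≤ n →
    1 / (2 * ((K : ℝ) + 1)) * (1 + θ * y) ≤ |(q : ℝ) * y - p| * (q + θ * p) := by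
  induction n with
  | zero => intro y _ _ _ θ _ q p hq hp hn; push_cast at hn; omega
  | succ n ih =>
    intro y hirr hy hK θ hθ q p hq hp hn
    have ha : (⌊y⁻¹⌋ : ℤ) ≤ K := by simpa [cfCoeff] using hK 0
    have hq' : (1 : ℝ) ≤ q := by exact_mod_cast hq
    have hp' : (0 : ℝ) ≤ p := by exact_mod_cast hp
    have hsmall : 1 / (2 * ((K : ℝ) + 1)) * (1 + θ * y) ≤ y := by
      have h1 : y⁻¹ < K + 1 := by
        have := Int.lt_floor_add_one y⁻¹
        have h2 : (⌊y⁻¹⌋ : ℝ) ≤ K := by exact_mod_cast ha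
        linarith
      have h3 : 1 / ((K : ℝ) + 1) < y := by
        rw [one_div]; exact inv_lt_of_inv_lt₀ hy.1 h1
      have h4 : 1 + θ * y ≤ 2 := by nlinarith [hθ.1, hθ.2, hy.1, hy.2]
      have h5 : 1 / (2 * ((K : ℝ) + 1)) * 2 = 1 / ((K : ℝ) + 1) := by field_simp
      have h6 : 0 < 1 / (2 * ((K : ℝ) + 1)) := by positivity
      nlinarith
    have hbig : 1 ≤ (q : ℝ) + θ * p := by nlinarith [mul_nonneg hθ.1 hp']
    have hy0 := hy.1
    have key : y ≤ |(q : ℝ) * y - p| →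
        1 / (2 * ((K : ℝ) + 1)) * (1 + θ * y) ≤ |(q : ℝ) * y - p| * (q + θ * p) := by
      intro h
      refine hsmall.trans (h.trans (le_mul_of_one_le_right (abs_nonneg _) hbig))
    rcases hp.eq_or_lt with rfl | hp1
    · apply key
      refine le_trans ?_ (le_abs_self _)
      push_cast
      nlinarith
    by_cases hlt : q < ⌊y⁻¹⌋ * p
    · exact key (le_abs_of_lt_floor_mul hy.1 hp hlt)
    have ha1 := one_le_floor_inv hy
    have ha1' : (1 : ℝ) ≤ ⌊y⁻¹⌋ := by exact_mod_cast ha1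
    have hpos : 0 < (⌊y⁻¹⌋ : ℝ) + θ := by linarith [hθ.1]
    apply approx_descent hy.1 hpos
    have := ih (gaussMap y) (gaussMap_irrational hirr) (gaussMap_mem hirr)
      (fun j => (cfCoeff_gaussMap y j).trans_le (hK (j + 1))) ((⌊y⁻¹⌋ : ℝ) + θ)⁻¹
      ⟨by positivity, inv_le_one_of_one_le₀ (by linarith [hθ.1])⟩ p (q - ⌊y⁻¹⌋ * p)
      hp1 (by linarith) (by push_cast at hn; nlinarith)
    push_cast at this
    exact this

theorem exists_approx_of_cfCoeff_le {K : ℕ} (k : ℕ) : ∀ (y : ℝ), Irrational y →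
    y ∈ Set.Ioo (0 : ℝ) 1 → (∀ j ≥ k, cfCoeff y (j + 1) ≤ K) → ∀ θ ∈ Set.Icc (0 : ℝ) 1,
    ∃ N : ℕ, ∀ q p : ℤ, N ≤ q → 0 ≤ p →
    1 / (2 * ((K : ℝ) + 1)) * (1 + θ * y) ≤ |(q : ℝ) * y - p| * (q + θ * p) := by
  induction k with
  | zero =>
    intro y hirr hy hK θ hθ
    refine ⟨1, fun q p hq hp => ?_⟩
    exact approx_of_cfCoeff_le (q + p).toNat y hirr hy (fun j => hK j (Nat.zero_le _)) θ hθ q p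
      (by exact_mod_cast hq) hp (Int.self_le_toNat _)
  | succ k ih =>
    intro y hirr hy hK θ hθ
    have ha1 := one_le_floor_inv hy
    have ha1' : (1 : ℝ) ≤ ⌊y⁻¹⌋ := by exact_mod_cast ha1
    have hpos : 0 < (⌊y⁻¹⌋ : ℝ) + θ := by linarith [hθ.1]
    obtain ⟨N, hN⟩ := ih (gaussMap y) (gaussMap_irrational hirr) (gaussMap_mem hirr)
      (fun j hj => (cfCoeff_gaussMap y j).trans_le (hK (j + 1) (by omega)))
      ((⌊y⁻¹⌋ : ℝ) + θ)⁻¹ ⟨by positivity, inv_le_one_of_one_le₀ (by linarith [hθ.1])⟩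
    obtain ⟨M, hM⟩ := exists_nat_ge ((N + 1) / y)
    refine ⟨M, fun q p hq hp => ?_⟩
    have hy0 := hy.1
    have hp' : (0 : ℝ) ≤ p := by exact_mod_cast hp
    have hqy : (N : ℝ) + 1 ≤ q * y := by
      rw [← div_le_iff₀ hy0]
      exact hM.trans (by exact_mod_cast hq)
    have hN0 : (0 : ℝ) ≤ N := N.cast_nonneg
    have hq1 : (1 : ℝ) ≤ q := by nlinarith [hy.2]
    have hsmall : 1 / (2 * ((K : ℝ) + 1)) * (1 + θ * y) ≤ 1 := by
      have h4 : 1 + θ * y ≤ 2 := by nlinarith [hθ.1, hθ.2, hy.1, hy.2]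
      have hK0 : (0 : ℝ) ≤ K := K.cast_nonneg
      rw [one_div_mul_eq_div, div_le_one (by positivity)]
      linarith
    have hsum : (q : ℝ) ≤ q + θ * p := by linarith [mul_nonneg hθ.1 hp']
    by_cases hlt : q < ⌊y⁻¹⌋ * p
    · have := le_abs_of_lt_floor_mul hy.1 hp hlt
      calc _ ≤ (1 : ℝ) := hsmall
        _ ≤ q * y := by linarith
        _ = y * q := mul_comm _ _
        _ ≤ _ := by gcongr
    by_cases hge : 1 ≤ |(q : ℝ) * y - p|
    · exact hsmall.trans (one_le_mul_of_one_le_of_one_le hge (hq1.trans hsum))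
    have hpN : (N : ℝ) ≤ p := by linarith [(abs_lt.mp (not_le.mp hge)).2]
    apply approx_descent hy.1 hpos
    have := hN p (q - ⌊y⁻¹⌋ * p) (by exact_mod_cast hpN) (by linarith)
    push_cast at this
    exact this

theorem exists_mul_abs_sub_ge {K k : ℕ} {y : ℝ} (hirr : Irrational y)
    (hy : y ∈ Set.Ioo (0 : ℝ) 1) (hK : ∀ j ≥ k, cfCoeff y (j + 1) ≤ K) :
    ∃ N : ℕ, ∀ q p : ℤ, N ≤ |q| →
    1 / (2 * ((K : ℝ) + 1)) ≤ |(q : ℝ)| * |(q : ℝ) * y - p| := by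
  obtain ⟨N, hN⟩ := exists_approx_of_cfCoeff_le k y hirr hy hK 0 ⟨le_rfl, zero_le_one⟩
  obtain ⟨M, hM⟩ := exists_nat_ge (1 / y)
  have hpos : ∀ q p : ℤ, (max N (max M 1) : ℕ) ≤ q →
      1 / (2 * ((K : ℝ) + 1)) ≤ |(q : ℝ)| * |(q : ℝ) * y - p| := by
    intro q p hq
    have hqN : (N : ℤ) ≤ q := le_trans (by exact_mod_cast le_max_left _ _) hq
    have hqM : (M : ℤ) ≤ q :=
      le_trans (by exact_mod_cast (le_max_left M 1).trans (le_max_right _ _)) hq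
    have hq1 : ((1 : ℕ) : ℤ) ≤ q :=
      le_trans (by exact_mod_cast (le_max_right M 1).trans (le_max_right _ _)) hq
    have hq1' : (1 : ℝ) ≤ q := by exact_mod_cast hq1
    rcases le_or_gt 0 p with hp | hp
    · have := hN q p hqN hp
      rw [abs_of_pos (by linarith : (0 : ℝ) < q)]
      simpa [mul_comm] using this
    · have hqy : 1 ≤ (q : ℝ) * y := by
        rw [← div_le_iff₀ hy.1]
        exact hM.trans (by exact_mod_cast hqM)
      have hp' : (p : ℝ) ≤ 0 := by exact_mod_cast hp.le
      have hK0 : (0 : ℝ) ≤ K := K.cast_nonneg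
      have hδ : 1 / (2 * ((K : ℝ) + 1)) ≤ 1 := by
        rw [div_le_one (by positivity)]; linarith
      refine hδ.trans (one_le_mul_of_one_le_of_one_le (hq1'.trans (le_abs_self _)) ?_)
      exact le_trans (by linarith) (le_abs_self _)
  refine ⟨max N (max M 1), fun q p hq => ?_⟩
  rcases abs_choice q with h | h
  · exact hpos q p (h ▸ hq)
  · have := hpos (-q) (-p) (h ▸ hq)
    push_cast at this
    rw [abs_neg] at this
    convert this using 2
    rw [← abs_neg]
    congr 1
    ring

/-- The unimodular form `T² (X - x Y)² + Y² / T²`. -/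
noncomputable def geodesicForm (x T : ℝ) : BinForm :=
  ⟨T ^ 2, -(T ^ 2 * x), T ^ 2 * x ^ 2 + 1 / T ^ 2⟩

theorem geodesicForm_isUnimodular (x : ℝ) {T : ℝ} (hT : 0 < T) :
    (geodesicForm x T).IsUnimodular := by
  refine ⟨by simpa [geodesicForm] using pow_pos hT 2, ?_⟩
  simp only [geodesicForm]
  field_simp
  ring

theorem geodesicForm_dil_ev (x : ℝ) {T : ℝ} (hT : 0 < T) {m : ℝ} (hm : m ≠ 0) (X Y : ℝ) :
    ((geodesicForm x T).dil m).ev X Y =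
      T ^ 2 / m ^ 2 * (X - Y * (m ^ 2 * x)) ^ 2 + m ^ 2 / T ^ 2 * Y ^ 2 := by
  rw [BinForm.ev_dil _ hm]
  simp only [geodesicForm, BinForm.ev]
  field_simp
  ring

theorem exists_pos_le_abs_sub {z : ℝ} (hz : Irrational z) (b : ℤ) :
    ∃ c > 0, ∀ a : ℤ, (a ≠ 0 ∨ b ≠ 0) → c ≤ |(a : ℝ) - b * z| := by
  by_cases hb : b = 0
  · subst hb
    refine ⟨1, one_pos, fun a ha => ?_⟩
    have : a ≠ 0 := by simpa using ha
    have h1 : 1 ≤ |a| := Int.one_le_abs this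
    simpa using (by exact_mod_cast h1 : (1 : ℝ) ≤ |(a : ℝ)|)
  · refine ⟨|(b : ℝ) * z - round ((b : ℝ) * z)|, ?_, fun a _ => ?_⟩
    · rw [gt_iff_lt, abs_pos, sub_ne_zero]
      exact (hz.intCast_mul hb).ne_int _
    · rw [abs_sub_comm (a : ℝ)]
      exact round_le _ a

theorem eventually_le_geodesicForm_dil_ev {x δ : ℝ} (hx : Irrational x) {m N : ℕ} (hm : 1 ≤ m)
    (hδ : 0 < δ) (hN : ∀ q p : ℤ, N ≤ |q| →
      δ ≤ |(q : ℝ)| * |(q : ℝ) * Int.fract ((m : ℝ) ^ 2 * x) - p|) :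
    ∀ᶠ T : ℝ in atTop, ∀ a b : ℤ, (a ≠ 0 ∨ b ≠ 0) →
      δ ≤ ((geodesicForm x T).dil m).ev a b := by
  have hm0 : (0 : ℝ) < m := by exact_mod_cast hm
  have hz : Irrational ((m : ℝ) ^ 2 * x) := by
    have := hx.natCast_mul (m := m ^ 2) (by positivity)
    simpa using this
  have hfin : ∀ᶠ T : ℝ in atTop, ∀ b ∈ Set.Icc (-(N : ℤ)) N, ∀ a : ℤ, (a ≠ 0 ∨ b ≠ 0) →
      δ ≤ T ^ 2 / m ^ 2 * ((a : ℝ) - b * (m ^ 2 * x)) ^ 2 := by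
    rw [eventually_all_finite (Set.finite_Icc _ _)]
    intro b _
    obtain ⟨c, hc, hca⟩ := exists_pos_le_abs_sub hz b
    have hT : Tendsto (fun T : ℝ => T ^ 2 * (c ^ 2 / m ^ 2)) atTop atTop :=
      (tendsto_pow_atTop two_ne_zero).atTop_mul_const (by positivity)
    filter_upwards [hT.eventually_ge_atTop δ] with T hT a hab
    calc δ ≤ T ^ 2 * (c ^ 2 / m ^ 2) := hT
      _ = T ^ 2 / m ^ 2 * c ^ 2 := by ring
      _ ≤ T ^ 2 / m ^ 2 * |(a : ℝ) - b * (m ^ 2 * x)| ^ 2 := by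
        have := hca a hab
        gcongr
      _ = _ := by rw [sq_abs]
  filter_upwards [hfin, eventually_gt_atTop 0] with T hfinT hT a b hab
  rw [geodesicForm_dil_ev x hT hm0.ne']
  by_cases hb : |b| ≤ N
  · have h1 := hfinT b (abs_le.mp hb) a hab
    have h2 : 0 ≤ (m : ℝ) ^ 2 / T ^ 2 * (b : ℝ) ^ 2 := by positivity
    linarith
  · have h := hN b (a - b * ⌊(m : ℝ) ^ 2 * x⌋) (not_le.mp hb).le
    have e : (b : ℝ) * Int.fract ((m : ℝ) ^ 2 * x) - ((a - b * ⌊(m : ℝ) ^ 2 * x⌋ : ℤ) : ℝ) =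
        -((a : ℝ) - b * (m ^ 2 * x)) := by
      rw [Int.fract]; push_cast; ring
    rw [e, abs_neg] at h
    set u := (a : ℝ) - b * (m ^ 2 * x)
    have h3 := two_mul_le_add_sq (T / m * |u|) (m / T * |(b : ℝ)|)
    have h4 : 2 * (T / m * |u|) * (m / T * |(b : ℝ)|) = 2 * (|(b : ℝ)| * |u|) := by
      field_simp
    rw [h4, mul_pow, mul_pow, div_pow, div_pow, sq_abs, sq_abs] at h3
    linarith

theorem exists_le_cfLimsup {x : ℝ} (hx : Irrational x) (K : ℕ) :
    ∃ m : ℕ, 0 < m ∧ (K : EReal) ≤ cfLimsup (Int.fract ((m : ℝ) ^ 2 * x)) := by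
  by_contra! hcon
  have hδ : 0 < 1 / (2 * ((K : ℝ) + 1)) := by positivity
  obtain ⟨B, hB⟩ := BinForm.exists_not_good hδ
  have hev : ∀ᶠ T : ℝ in atTop, ∀ m ∈ Set.Icc 1 B, ∀ a b : ℤ, (a ≠ 0 ∨ b ≠ 0) →
      1 / (2 * ((K : ℝ) + 1)) ≤ ((geodesicForm x T).dil m).ev a b := by
    rw [eventually_all_finite (Set.finite_Icc _ _)]
    intro m hm
    have hz : Irrational ((m : ℝ) ^ 2 * x) := by
      have := hx.natCast_mul (m := m ^ 2) (by have := hm.1; positivity)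
      simpa using this
    have hf : Irrational (Int.fract ((m : ℝ) ^ 2 * x)) := hz.sub_intCast _
    obtain ⟨k, hk⟩ := eventually_atTop.mp (eventually_lt_of_limsup_lt (hcon m hm.1))
    obtain ⟨N, hN⟩ := exists_mul_abs_sub_ge (K := K) (k := k) hf
      ⟨lt_of_le_of_ne (Int.fract_nonneg _) fun h => hf.ne_zero h.symm, Int.fract_lt_one _⟩
      (fun j hj => by
        have h1 : ((cfCoeff (Int.fract ((m : ℝ) ^ 2 * x)) (j + 1) : ℝ) : EReal) <
          ((K : ℝ) : EReal) := by simpa using hk j hj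
        have h2 := EReal.coe_lt_coe_iff.mp h1
        exact_mod_cast h2.le)
    exact eventually_le_geodesicForm_dil_ev hx hm.1 hδ hN
  obtain ⟨T, hT, hT0⟩ := (hev.and (eventually_gt_atTop 0)).exists
  exact hB _ (geodesicForm_isUnimodular x hT0) fun m h1 h2 => hT m ⟨h1, h2⟩

/-- Boshernitzan's conjecture: for every irrational `x ∈ [0,1]`,
`sup_n c({n²·x}) = ∞`, where `c(s)` is the limsup of the continued fraction
coefficients of `s`. -/
theorem stmt5 (x : ℝ) (hx : Irrational x) (hx01 : x ∈ Set.Icc (0 : ℝ) 1) :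
    (⨆ n : {n : ℕ // 0 < n}, cfLimsup (Int.fract (((n : ℕ) : ℝ) ^ 2 * x))) = ⊤ := by
  rw [EReal.eq_top_iff_forall_lt]
  intro y
  obtain ⟨K, hK⟩ := exists_nat_gt y
  obtain ⟨m, hm, hle⟩ := exists_le_cfLimsup hx K
  calc (y : EReal) < ((K : ℝ) : EReal) := EReal.coe_lt_coe_iff.mpr hK
    _ = (K : EReal) := by simp
    _ ≤ _ := hle
    _ ≤ _ := le_iSup (fun n : {n : ℕ // 0 < n} =>
      cfLimsup (Int.fract (((n : ℕ) : ℝ) ^ 2 * x))) ⟨m, hm⟩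
end

section
/- Fix d ≥ 1 and ε ∈ (0,1). There exists δ > 0, depending only on ε and d, with the following property: for every v ∈ ℝ^d, if the inequality ‖k·v − m‖_∞ < ε/k^{1/d} has only finitely many solutions (m,k) ∈ ℤ^d × ℤ with k ≥ 1, then there exists T > 0 such that for all t > T, every nonzero vector of the lattice Λ_{t,v} = a_t u_v ℤ^{d+1} has sup-norm at least δ. -/
/-- The general vector of the lattice `Λ_{t,v} = a_t u_v ℤ^{d+1}`:
`(e^t(m₁ − k·v₁),…, e^t(m_d − k·v_d), e^{−dt}·k)`.  The sup-norm on `Fin (d+1) → ℝ` is the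
usual Pi (sup) norm. -/
noncomputable def latVec (d : ℕ) (t : ℝ) (v : Fin d → ℝ) (m : Fin d → ℤ) (k : ℤ) :
    Fin (d + 1) → ℝ :=
  Fin.snoc (fun i => Real.exp t * ((m i : ℝ) - (k : ℝ) * v i))
    (Real.exp (-(d * t)) * (k : ℝ))

open Filter

/-- The sup-norm ball condition on a lattice vector, read coordinatewise. -/
theorem norm_latVec_lt_iff {d : ℕ} {t δ : ℝ} (hδ : 0 < δ) (v : Fin d → ℝ) (m : Fin d → ℤ) (k : ℤ) :
    ‖latVec d t v m k‖ < δ ↔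
      (∀ i, Real.exp t * |(k : ℝ) * v i - m i| < δ) ∧ Real.exp (-(d * t)) * |(k : ℝ)| < δ := by
  simp [pi_norm_lt_iff hδ, latVec, Fin.forall_fin_succ', abs_mul, abs_sub_comm]

/-- A short lattice vector with `k ≥ 1` gives a good approximation of `v`. -/
theorem abs_lt_div_rpow_of_short {d : ℕ} (hd : 1 ≤ d) {ε t x : ℝ} {k : ℤ} (hε1 : ε < 1)
    (hk : 1 ≤ k) (hx : Real.exp t * |x| < ε) (hkt : Real.exp (-(d * t)) * |(k : ℝ)| < ε) :
    |x| < ε / (k : ℝ) ^ ((1 : ℝ) / d) := by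
  have hd0 : (d : ℝ) ≠ 0 := by positivity
  have hk0 : (0 : ℝ) < k := by exact_mod_cast hk
  have hkexp : (k : ℝ) ≤ Real.exp (d * t) := by
    rw [abs_of_pos hk0, Real.exp_neg, inv_mul_lt_iff₀ (Real.exp_pos _)] at hkt
    nlinarith [Real.exp_pos (d * t)]
  have hroot : (k : ℝ) ^ ((1 : ℝ) / d) ≤ Real.exp t := by
    calc (k : ℝ) ^ ((1 : ℝ) / d) ≤ Real.exp (d * t) ^ ((1 : ℝ) / d) :=
          Real.rpow_le_rpow hk0.le hkexp (by positivity)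
      _ = Real.exp t := by rw [← Real.exp_mul]; congr 1; field_simp
  rw [lt_div_iff₀ (Real.rpow_pos_of_pos hk0 _), mul_comm]
  exact (mul_le_mul_of_nonneg_right hroot (abs_nonneg x)).trans_lt hx

/-- If `k • v` is an integral vector for some `k ≥ 1`, then `v` has infinitely many good
approximations. -/
theorem infinite_of_exact {d : ℕ} {ε : ℝ} (hε : 0 < ε) {v : Fin d → ℝ} {m : Fin d → ℤ} {k : ℤ}
    (hk : 1 ≤ k) (h : ∀ i, (k : ℝ) * v i = m i) :
    {p : (Fin d → ℤ) × ℤ | 1 ≤ p.2 ∧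
      ∀ i, |(p.2 : ℝ) * v i - (p.1 i : ℝ)| < ε / (p.2 : ℝ) ^ ((1 : ℝ) / d)}.Infinite := by
  refine Set.infinite_of_injective_forall_mem
    (f := fun n : ℕ => (((n + 1 : ℤ) • m, (n + 1 : ℤ) * k) : (Fin d → ℤ) × ℤ)) ?_ ?_
  · intro a b hab
    have hab' := mul_right_cancel₀ (by lia : k ≠ 0) (Prod.ext_iff.1 hab).2
    lia
  · intro n
    have hnk : (1 : ℤ) ≤ (n + 1 : ℤ) * k := by nlinarith
    refine ⟨hnk, fun i => ?_⟩
    have hpos : (0 : ℝ) < (((n + 1 : ℤ) * k : ℤ) : ℝ) := by exact_mod_cast hnk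
    have hzero : (((n + 1 : ℤ) * k : ℤ) : ℝ) * v i - (((n + 1 : ℤ) • m) i : ℤ) = 0 := by
      push_cast [Pi.smul_apply, smul_eq_mul]
      rw [← h i]; ring
    simp only [hzero, abs_zero]
    exact div_pos hε (Real.rpow_pos_of_pos hpos _)

/-- for every `d ≥ 1` and `ε ∈ (0,1)` there is `δ > 0` such that for all
`v ∈ ℝ^d`, if `‖k·v − m‖_∞ < ε/k^(1/d)` has only finitely many solutions with `k ≥ 1`,
then for all large `t` every nonzero vector of `Λ_{t,v}` has sup-norm at least `δ`. -/
theorem stmt6 (d : ℕ) (hd : 1 ≤ d) (ε : ℝ) (hε : 0 < ε) (hε1 : ε < 1) :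
    ∃ δ : ℝ, 0 < δ ∧ ∀ v : Fin d → ℝ,
      {p : (Fin d → ℤ) × ℤ | 1 ≤ p.2 ∧
          ∀ i, |(p.2 : ℝ) * v i - (p.1 i : ℝ)| < ε / (p.2 : ℝ) ^ ((1 : ℝ) / d)}.Finite →
      ∃ T : ℝ, 0 < T ∧ ∀ t : ℝ, T < t → ∀ (m : Fin d → ℤ) (k : ℤ),
        ¬(m = 0 ∧ k = 0) → δ ≤ ‖latVec d t v m k‖ := by
  refine ⟨ε, hε, fun v hfin => ?_⟩
  have eventually_far : ∀ᶠ t : ℝ in atTop, ∀ p ∈ {p : (Fin d → ℤ) × ℤ | 1 ≤ p.2 ∧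
      ∀ i, |(p.2 : ℝ) * v i - (p.1 i : ℝ)| < ε / (p.2 : ℝ) ^ ((1 : ℝ) / d)},
      ∃ i, Real.exp (-t) < |(p.2 : ℝ) * v i - p.1 i| := by
    refine (eventually_all_finite hfin).2 fun p hp => ?_
    obtain ⟨i, hi⟩ : ∃ i, (p.2 : ℝ) * v i ≠ p.1 i := by
      by_contra! h
      exact infinite_of_exact hε hp.1 h hfin
    filter_upwards [Real.tendsto_exp_neg_atTop_nhds_zero.eventually_lt_const
      (abs_pos.2 (sub_ne_zero.2 hi))] with t ht using ⟨i, ht⟩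
  obtain ⟨T, hT⟩ := eventually_atTop.1 eventually_far
  refine ⟨max T 1, by positivity, fun t ht m k hmk => ?_⟩
  have hTt : T ≤ t := (le_max_left _ _).trans ht.le
  have ht0 : 0 < t := zero_lt_one.trans ((le_max_right _ _).trans_lt ht)
  have long_of_pos : ∀ (m : Fin d → ℤ) (k : ℤ), 1 ≤ k → ε ≤ ‖latVec d t v m k‖ := by
    intro m k hk
    by_contra! hlt
    obtain ⟨hm, hkt⟩ := (norm_latVec_lt_iff hε v m k).1 hlt
    obtain ⟨i, hi⟩ := hT t hTt (m, k)
      ⟨hk, fun i => abs_lt_div_rpow_of_short hd hε1 hk (hm i) hkt⟩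
    have h1 : Real.exp t * Real.exp (-t) < ε :=
      (mul_lt_mul_of_pos_left hi (Real.exp_pos t)).trans (hm i)
    rw [← Real.exp_add, add_neg_cancel, Real.exp_zero] at h1
    linarith
  rcases lt_trichotomy k 0 with hk | rfl | hk
  · have hneg : latVec d t v (-m) (-k) = -latVec d t v m k := by
      ext i
      refine Fin.lastCases ?_ (fun j => ?_) i
      · simp [latVec]
      · simp [latVec]
        ring
    rw [← norm_neg, ← hneg]
    exact long_of_pos _ _ (by lia)
  · by_contra! hlt
    have hm := ((norm_latVec_lt_iff hε v m 0).1 hlt).1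
    refine hmk ⟨funext fun i => Int.abs_lt_one_iff.1 ?_, rfl⟩
    have hmi := hm i
    simp only [Int.cast_zero, zero_mul, zero_sub, abs_neg] at hmi
    have hone := Real.one_le_exp ht0.le
    have : |(m i : ℝ)| < 1 := by nlinarith [abs_nonneg (m i : ℝ)]
    exact_mod_cast this
  · exact long_of_pos m k hk
end

section
/- Fix d ≥ 1 and let v ∈ ℝ^d be a vector which is not well approximable. Then the trajectory {a_t u_v ℤ^{d+1}}_{t ≥ 0} is uniformly nondegenerate: there exists δ > 0 such that for every t ≥ 0, every nonzero vector of the lattice Λ_{t,v} = a_t u_v ℤ^{d+1} has sup-norm at least δ. -/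
/-- A vector `v ∈ ℝ^d` is well approximable: for every `ε > 0` there are `m ∈ ℤ^d` and a
positive integer `k` with `‖k·v − m‖_∞ < ε/k^(1/d)`. -/
def IsWAVec (d : ℕ) (v : Fin d → ℝ) : Prop :=
  ∀ ε : ℝ, 0 < ε → ∃ (m : Fin d → ℤ) (k : ℕ), 0 < k ∧
    ∀ i, |(k : ℝ) * v i - (m i : ℝ)| < ε / (k : ℝ) ^ ((1 : ℝ) / d)

lemma abs_le_norm_latVec (d : ℕ) (t : ℝ) (v : Fin d → ℝ) (m : Fin d → ℤ) (k : ℤ) (i : Fin d) :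
    Real.exp t * |(k : ℝ) * v i - (m i : ℝ)| ≤ ‖latVec d t v m k‖ := by
  have h := norm_le_pi_norm (latVec d t v m k) i.castSucc
  rwa [latVec, Fin.snoc_castSucc, Real.norm_eq_abs, abs_mul, Real.abs_exp, abs_sub_comm,
    ← latVec] at h

lemma exp_mul_abs_le_norm_latVec (d : ℕ) (t : ℝ) (v : Fin d → ℝ) (m : Fin d → ℤ) (k : ℤ) :
    Real.exp (-(d * t)) * |(k : ℝ)| ≤ ‖latVec d t v m k‖ := by
  have h := norm_le_pi_norm (latVec d t v m k) (Fin.last d)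
  rwa [latVec, Fin.snoc_last, Real.norm_eq_abs, abs_mul, Real.abs_exp, ← latVec] at h

lemma latVec_neg (d : ℕ) (t : ℝ) (v : Fin d → ℝ) (m : Fin d → ℤ) (k : ℤ) :
    latVec d t v (-m) (-k) = -latVec d t v m k := by
  funext i
  refine Fin.lastCases ?_ (fun j => ?_) i
  · simp [latVec]
  · simp only [latVec, Fin.snoc_castSucc, Pi.neg_apply]
    push_cast
    ring

/-- if `v ∈ ℝ^d` is not well approximable, then the trajectory
`{a_t u_v ℤ^{d+1}}_{t ≥ 0}` is uniformly nondegenerate: there is `δ > 0` such that for all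
`t ≥ 0` every nonzero vector of `Λ_{t,v}` has sup-norm at least `δ`. -/
theorem stmt7 (d : ℕ) (hd : 1 ≤ d) (v : Fin d → ℝ) (hv : ¬ IsWAVec d v) :
    ∃ δ : ℝ, 0 < δ ∧ ∀ t : ℝ, 0 ≤ t → ∀ (m : Fin d → ℤ) (k : ℤ),
      ¬(m = 0 ∧ k = 0) → δ ≤ ‖latVec d t v m k‖ := by
  unfold IsWAVec at hv
  push Not at hv
  obtain ⟨ε, hε, hv⟩ := hv
  have key : ∀ t : ℝ, ∀ (m : Fin d → ℤ) (k : ℕ), 0 < k →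
      min 1 ε ≤ ‖latVec d t v m k‖ := by
    intro t m k hk
    by_contra! hlt
    have hk' : (0 : ℝ) < k := by exact_mod_cast hk
    have hlast := (exp_mul_abs_le_norm_latVec d t v m k).trans_lt
      (hlt.trans_le (min_le_left _ _))
    rw [Int.cast_natCast, abs_of_pos hk', Real.exp_neg, inv_mul_lt_one₀ (Real.exp_pos _)] at hlast
    have hroot : (k : ℝ) ^ ((1 : ℝ) / d) ≤ Real.exp t := by
      have hd' : (d : ℝ) ≠ 0 := by positivity
      calc (k : ℝ) ^ ((1 : ℝ) / d) ≤ Real.exp (d * t) ^ ((1 : ℝ) / d) := by gcongr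
        _ = Real.exp t := by rw [← Real.exp_mul]; congr 1; field_simp
    obtain ⟨i, hi⟩ := hv m k hk
    have hcoord := (abs_le_norm_latVec d t v m k i).trans_lt
      (hlt.trans_le (min_le_right _ _))
    rw [Int.cast_natCast] at hcoord
    rw [div_le_iff₀ (by positivity)] at hi
    nlinarith [abs_nonneg ((k : ℝ) * v i - (m i : ℝ))]
  refine ⟨min 1 ε, lt_min one_pos hε, fun t ht m k hmk => ?_⟩
  rcases lt_trichotomy k 0 with hk | rfl | hk
  · have h := key t (-m) k.natAbs (by omega)
    rwa [show (k.natAbs : ℤ) = -k by omega, latVec_neg, norm_neg] at h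
  · obtain ⟨i, hi⟩ : ∃ i, m i ≠ 0 := Function.ne_iff.mp fun h => hmk ⟨h, rfl⟩
    refine (min_le_left _ _).trans (le_trans ?_ (abs_le_norm_latVec d t v m 0 i))
    have hm : (1 : ℝ) ≤ |(m i : ℝ)| := by exact_mod_cast Int.one_le_abs hi
    simpa using one_le_mul_of_one_le_of_one_le (Real.one_le_exp ht) hm
  · have h := key t m k.natAbs (by omega)
    rwa [show (k.natAbs : ℤ) = k by omega] at h
end
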